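/- arXiv:2511.14867 — 2 statements merged into one kernel-verified Lean document; each statement's English description precedes it below -/
import Mathlib

section
/- There exist integers N₀ and M₀ such that for every odd integer m ≥ M₀ and every integer n with n ≥ N₀ and n ≥ 4m, the Ramsey number R(K_{2,n}, W_m) equals 3n + 4; that is, every graph Γ on 3n + 4 vertices contains a copy of K_{2,n} or its complement contains a copy of W_m, while there exists a graph on 3n + 3 vertices containing no copy of K_{2,n} whose complement contains no copy of W_m. -/
open SimpleGraph

/-- `ContainsCopy Γ H` : `Γ` contains a copy of `H`, i.e. `H` is isomorphic to a subgraph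
of `Γ`; equivalently, there is an injective graph homomorphism from `H` to `Γ`. -/
def ContainsCopy {α β : Type*} (Γ : SimpleGraph α) (H : SimpleGraph β) : Prop :=
  ∃ f : H →g Γ, Function.Injective f

/-- The wheel graph `W_m` on `m+1` vertices: the join of a single hub vertex (`none`)
with the cycle `C_m` (on the vertices `some i`). -/
def wheelGraph (m : ℕ) : SimpleGraph (Option (Fin m)) :=
  SimpleGraph.fromRel (fun x y =>
    x = none ∨ ∃ i j : Fin m, x = some i ∧ y = some j ∧ (SimpleGraph.cycleGraph m).Adj i j)

open Finset Classical in
/-- A bipartite relation with more than `d (|A| + |B|)` pairs contains a nonempty sub-pair in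
which every vertex has at least `d` partners. -/
lemma exists_minDegree_subpair {V : Type*} (r : V → V → Prop) (d : ℕ) (A B : Finset V)
    (h : d * (#A + #B) < ∑ a ∈ A, #{b ∈ B | r a b}) :
    ∃ A' ⊆ A, ∃ B' ⊆ B, A'.Nonempty ∧ (∀ a ∈ A', d ≤ #{b ∈ B' | r a b}) ∧
      ∀ b ∈ B', d ≤ #{a ∈ A' | r a b} := by
  induction hk : #A + #B using Nat.strong_induction_on generalizing A B with
  | _ k ih =>
  subst hk
  by_cases hA : ∀ a ∈ A, d ≤ #{b ∈ B | r a b}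
  · by_cases hB : ∀ b ∈ B, d ≤ #{a ∈ A | r a b}
    · refine ⟨A, subset_rfl, B, subset_rfl, ?_, hA, hB⟩
      rw [nonempty_iff_ne_empty]
      rintro rfl
      simp at h
    · push Not at hB
      obtain ⟨b, hb, hbd⟩ := hB
      have hc := card_erase_add_one hb
      have hcomm := sum_card_bipartiteAbove_eq_sum_card_bipartiteBelow (s := A) (t := B) r
      have hcomm' := sum_card_bipartiteAbove_eq_sum_card_bipartiteBelow (s := A) (t := B.erase b) r
      simp only [bipartiteAbove, bipartiteBelow] at hcomm hcomm'
      have hs := add_sum_erase B (fun b => #{a ∈ A | r a b}) hb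
      obtain ⟨A', hA', B', hB', h'⟩ := ih (#A + #(B.erase b)) (by omega) A (B.erase b)
        (by rw [hcomm']; rw [← hc] at h; nlinarith) rfl
      exact ⟨A', hA', B', hB'.trans (erase_subset _ _), h'⟩
  · push Not at hA
    obtain ⟨a, ha, had⟩ := hA
    have hc := card_erase_add_one ha
    have hs := add_sum_erase A (fun a => #{b ∈ B | r a b}) ha
    obtain ⟨A', hA', B', hB', h'⟩ := ih (#(A.erase a) + #B) (by omega) (A.erase a) B
      (by rw [← hc] at h; nlinarith) rfl
    exact ⟨A', hA'.trans (erase_subset _ _), B', hB', h'⟩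

open Classical in
/-- `PathTo H w U x`: there is a path in `H` from `w` to `x` whose vertex set is `U`. -/
inductive PathTo {V : Type*} (H : SimpleGraph V) (w : V) : Finset V → V → Prop
  | start : PathTo H w {w} w
  | step {U : Finset V} {x y : V} : PathTo H w U x → H.Adj x y → y ∉ U → PathTo H w (insert y U) y

open Finset Classical in
/-- A path starting inside a pair `(A, B)` of minimum degree `d` can be prolonged by any even
number of vertices below `d`, alternating between `A` and `B`. -/
lemma PathTo.alternate {V : Type*} {H : SimpleGraph V} {w : V} {d : ℕ} {A B U : Finset V} {p : V}
    (hA : ∀ a ∈ A, d ≤ #{b ∈ B | H.Adj a b}) (hB : ∀ b ∈ B, d ≤ #{a ∈ A | H.Adj a b})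
    (hU : PathTo H w U p) (hp : p ∈ A) (hdisj : #((A ∪ B) ∩ U) ≤ 2) (l : ℕ) (hl : 2 * l + 2 ≤ d) :
    ∃ U' p', PathTo H w U' p' ∧ p' ∈ A ∧ U' ⊆ U ∪ (A ∪ B) ∧ #U' = #U + 2 * l ∧
      #((A ∪ B) ∩ U') ≤ 2 * l + 2 := by
  induction l with
  | zero =>
    exact ⟨U, p, hU, hp, subset_union_left, rfl, hdisj⟩
  | succ l ih =>
    obtain ⟨U₁, p₁, hU₁, hp₁, hsub₁, hc₁, hi₁⟩ := ih (by omega)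
    obtain ⟨b, hb, hbU⟩ : ∃ b ∈ ({b ∈ B | H.Adj p₁ b} : Finset V), b ∉ (A ∪ B) ∩ U₁ :=
      exists_mem_notMem_of_card_lt_card (by have := hA p₁ hp₁; omega)
    simp only [mem_filter] at hb
    have hbU₁ : b ∉ U₁ := fun h => hbU (mem_inter.2 ⟨mem_union_right _ hb.1, h⟩)
    have hU₂ := hU₁.step hb.2 hbU₁
    have hi₂ : #((A ∪ B) ∩ insert b U₁) ≤ 2 * l + 3 := by
      rw [inter_insert_of_mem (mem_union_right _ hb.1)]
      exact (card_insert_le _ _).trans (by omega)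
    obtain ⟨a, ha, haU⟩ : ∃ a ∈ ({a ∈ A | H.Adj a b} : Finset V), a ∉ (A ∪ B) ∩ insert b U₁ :=
      exists_mem_notMem_of_card_lt_card (by have := hB b hb.1; omega)
    simp only [mem_filter] at ha
    have haU₁ : a ∉ insert b U₁ := fun h => haU (mem_inter.2 ⟨mem_union_left _ ha.1, h⟩)
    refine ⟨_, a, hU₂.step ha.2.symm haU₁, ha.1, ?_, ?_, ?_⟩
    · refine insert_subset (by simp [ha.1]) (insert_subset (by simp [hb.1]) hsub₁)
    · rw [card_insert_of_notMem haU₁, card_insert_of_notMem hbU₁]; omega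
    · rw [inter_insert_of_mem (mem_union_left _ ha.1)]
      exact (card_insert_le _ _).trans (by omega)

open Finset Classical in
/-- Two linked vertices: they have many common neighbours inside the reservoir `R`. -/
def Linked {V : Type*} [Fintype V] (H : SimpleGraph V) (R : Finset V) (h : ℕ) (x z : V) : Prop :=
  h ≤ #{a ∈ R | H.Adj x a ∧ H.Adj z a}

open Finset Classical in
/-- Prolong a path by four vertices `a, z, a', p`, with `a` and `a'` taken in the reservoir. -/
lemma PathTo.link {V : Type*} [Fintype V] {H : SimpleGraph V} {w : V} {U R F : Finset V}
    {h : ℕ} {x z p : V} (hU : PathTo H w U x) (hxz : Linked H R h x z) (hzp : Linked H R h z p)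
    (hUF : Disjoint U F) (hzU : z ∉ U) (hzR : z ∉ R) (hzF : z ∉ F) (hzp' : z ≠ p)
    (hpU : p ∉ U) (hR : #(U ∩ R) + 2 + #F < h) :
    ∃ U', PathTo H w (insert p U') p ∧ p ∉ U' ∧ #U' = #U + 3 ∧ U ⊆ U' ∧
      #(U' ∩ R) ≤ #(U ∩ R) + 2 ∧ Disjoint U' F ∧ U' ⊆ U ∪ R ∪ {z} := by
  obtain ⟨a, ha, haU⟩ : ∃ a ∈ ({a ∈ R | H.Adj x a ∧ H.Adj z a} : Finset V),
      a ∉ insert p ((U ∩ R) ∪ F) :=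
    exists_mem_notMem_of_card_lt_card <| by
      have h1 := card_insert_le p ((U ∩ R) ∪ F)
      have h2 := card_union_le (U ∩ R) F
      unfold Linked at hxz; omega
  obtain ⟨a', ha', haU'⟩ : ∃ a' ∈ ({a ∈ R | H.Adj z a ∧ H.Adj p a} : Finset V),
      a' ∉ insert a (insert p ((U ∩ R) ∪ F)) :=
    exists_mem_notMem_of_card_lt_card <| by
      have h1 := card_insert_le p ((U ∩ R) ∪ F)
      have h3 := card_insert_le a (insert p ((U ∩ R) ∪ F))
      have h2 := card_union_le (U ∩ R) F
      unfold Linked at hzp; omega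
  simp only [mem_filter, mem_insert, mem_union, mem_inter, not_or, not_and] at ha haU ha' haU'
  have haU1 : a ∉ U := fun h => haU.2.1 h ha.1
  have haU2 : a' ∉ U := fun h => haU'.2.2.1 h ha'.1
  have hza : z ≠ a := fun h => hzR (h ▸ ha.1)
  have hza' : z ≠ a' := fun h => hzR (h ▸ ha'.1)
  have q1 := hU.step ha.2.1 haU1
  have n2 : z ∉ insert a U := by simp [hza, hzU]
  have q2 := q1.step ha.2.2.symm n2
  have n3 : a' ∉ insert z (insert a U) := by simp [haU'.1, haU2, hza'.symm]
  have q3 := q2.step ha'.2.1 n3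
  have n4 : p ∉ insert a' (insert z (insert a U)) := by
    simp [hpU, Ne.symm haU.1, Ne.symm haU'.2.1, hzp'.symm]
  refine ⟨_, q3.step ha'.2.2.symm n4, n4, ?_, ?_, ?_, ?_, ?_⟩
  · rw [card_insert_of_notMem n3, card_insert_of_notMem n2, card_insert_of_notMem haU1]
  · intro u hu; simp [hu]
  · rw [insert_inter_of_mem ha'.1, insert_inter_of_notMem hzR, insert_inter_of_mem ha.1]
    have h1 := card_insert_le a (U ∩ R)
    have h3 := card_insert_le a' (insert a (U ∩ R))
    omega
  · simp only [disjoint_insert_left]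
    exact ⟨haU'.2.2.2, hzF, haU.2.2, hUF⟩
  · intro u hu
    simp only [mem_insert] at hu
    rcases hu with rfl | rfl | rfl | hu
    · simp [ha'.1]
    · simp
    · simp [ha.1]
    · simp [hu]

open Finset Classical in
/-- Concatenating `k` alternating blocks through the reservoir. -/
lemma PathTo.exists_blocks {V : Type*} [Fintype V] {H : SimpleGraph V} {X R F : Finset V}
    {d h M l₀ : ℕ} {w : V} (hw : w ∈ X) (hwF : w ∉ F) (hl₀ : 2 * l₀ + 2 ≤ d)
    (hblock : ∀ U : Finset V, #U ≤ M → ∃ A ⊆ X, ∃ B, A.Nonempty ∧ Disjoint (A ∪ B) (U ∪ R ∪ F) ∧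
      (∀ a ∈ A, d ≤ #{b ∈ B | H.Adj a b}) ∧ ∀ b ∈ B, d ≤ #{a ∈ A | H.Adj a b})
    (hlink : ∀ U : Finset V, #U ≤ M → ∀ x ∈ X, ∀ p ∈ X, ∃ z ∈ X, z ∉ U ∪ R ∪ F ∧ z ≠ p ∧
      Linked H R h x z ∧ Linked H R h z p)
    (k s : ℕ) (hs : s ≤ k * l₀) (hM : 1 + 4 * k + 2 * s ≤ M) (hh : 2 * k + 3 + #F < h) :
    ∃ U x, PathTo H w U x ∧ x ∈ X ∧ #U = 1 + 4 * k + 2 * s ∧ #(U ∩ R) ≤ 1 + 2 * k ∧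
      Disjoint U F := by
  induction k generalizing s with
  | zero =>
    obtain rfl : s = 0 := by omega
    refine ⟨{w}, w, .start, hw, by simp, ?_, by simpa using hwF⟩
    exact (card_le_card inter_subset_left).trans (by simp)
  | succ k ih =>
    rw [Nat.add_mul, one_mul] at hs
    obtain ⟨U, x, hU, hx, hUc, hUR, hUF⟩ := ih (s - min s l₀) (by omega) (by omega) (by omega)
    obtain ⟨A, hAX, B, ⟨p, hp⟩, hdisj, hA, hB⟩ := hblock U (by omega)
    obtain ⟨z, hzX, hz, hzp, hxz, hzp'⟩ := hlink U (by omega) x hx p (hAX hp)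
    simp only [mem_union, not_or] at hz
    have hpd := Finset.disjoint_left.1 hdisj (mem_union_left B hp)
    simp only [mem_union, not_or] at hpd
    obtain ⟨U', hU', hpU', hc', -, hR', hF', hsub'⟩ :=
      hU.link hxz hzp' hUF hz.1.1 hz.1.2 hz.2 hzp hpd.1.1 (by omega)
    have hAB : (A ∪ B) ∩ insert p U' ⊆ {p, z} := by
      intro u hu
      simp only [mem_inter, mem_insert] at hu
      obtain ⟨hu, rfl | hu'⟩ := hu
      · simp
      · have := hsub' hu'
        have hud := Finset.disjoint_left.1 hdisj hu
        simp only [mem_union, mem_singleton] at this hud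
        simp only [mem_insert, mem_singleton]
        tauto
    obtain ⟨U₂, x₂, hU₂, hx₂, hsub₂, hc₂, -⟩ := PathTo.alternate hA hB hU' hp
      ((card_le_card hAB).trans (card_le_two)) (min s l₀) (by omega)
    refine ⟨U₂, x₂, hU₂, hAX hx₂, ?_, ?_, ?_⟩
    · rw [hc₂, card_insert_of_notMem hpU']; omega
    · have : U₂ ∩ R ⊆ U' ∩ R := by
        intro u hu
        simp only [mem_inter] at hu ⊢
        refine ⟨?_, hu.2⟩
        have h1 := hsub₂ hu.1
        simp only [mem_union (s := insert p U'), mem_insert] at h1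
        rcases h1 with (rfl | h1) | h1
        · exact absurd hu.2 hpd.1.2
        · exact h1
        · exact absurd (mem_union_left F (mem_union_right U hu.2)) (Finset.disjoint_left.1 hdisj h1)
      have := card_le_card this
      omega
    · rw [Finset.disjoint_left]
      intro u hu huF
      have h1 := hsub₂ hu
      simp only [mem_union (s := insert p U'), mem_insert] at h1
      rcases h1 with (rfl | h1) | h1
      · exact hpd.2 huF
      · exact Finset.disjoint_left.1 hF' h1 huF
      · exact Finset.disjoint_left.1 hdisj h1 (mem_union_right _ huF)

open Finset Classical in
/-- A path of prescribed even order between `w` and `w'` that avoids `y`. -/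
lemma PathTo.exists_avoiding {V : Type*} [Fintype V] {H : SimpleGraph V} {X R : Finset V}
    {d h M l₀ k s : ℕ} {w w' p y : V} (hw : w ∈ X) (hp : p ∈ X) (hpw' : H.Adj p w')
    (hww' : w ≠ w') (hwp : w ≠ p) (hyw : y ≠ w) (hyw' : y ≠ w') (hyp : y ≠ p)
    (hl₀ : 2 * l₀ + 2 ≤ d)
    (hblock : ∀ U : Finset V, #U ≤ M + 3 → ∃ A ⊆ X, ∃ B, A.Nonempty ∧ Disjoint (A ∪ B) (U ∪ R) ∧
      (∀ a ∈ A, d ≤ #{b ∈ B | H.Adj a b}) ∧ ∀ b ∈ B, d ≤ #{a ∈ A | H.Adj a b})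
    (hlink : ∀ U : Finset V, #U ≤ M + 4 → ∀ x ∈ X, ∀ p ∈ X, ∃ z ∈ X, z ∉ U ∪ R ∧
      Linked H R h x z ∧ Linked H R h z p)
    (hs : s ≤ k * l₀) (hM : 1 + 4 * k + 2 * s ≤ M) (hh : 2 * k + 6 < h) :
    ∃ U, PathTo H w U w' ∧ #U = 6 + 4 * k + 2 * s ∧ y ∉ U := by
  have hF3 : #({w', p, y} : Finset V) ≤ 3 := card_le_three
  have hblock' : ∀ U : Finset V, #U ≤ M → ∃ A ⊆ X, ∃ B, A.Nonempty ∧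
      Disjoint (A ∪ B) (U ∪ R ∪ {w', p, y}) ∧
      (∀ a ∈ A, d ≤ #{b ∈ B | H.Adj a b}) ∧ ∀ b ∈ B, d ≤ #{a ∈ A | H.Adj a b} := by
    intro U hU
    obtain ⟨A, hAX, B, hA, hd, h'⟩ := hblock (U ∪ {w', p, y})
      ((card_union_le _ _).trans (by omega))
    exact ⟨A, hAX, B, hA, by rwa [union_right_comm], h'⟩
  have hlink' : ∀ U : Finset V, #U ≤ M → ∀ x ∈ X, ∀ q ∈ X, ∃ z ∈ X, z ∉ U ∪ R ∪ {w', p, y} ∧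
      z ≠ q ∧ Linked H R h x z ∧ Linked H R h z q := by
    intro U hU x hx q hq
    obtain ⟨z, hz, hzU, h'⟩ := hlink (insert q (U ∪ {w', p, y}))
      ((card_insert_le _ _).trans (by have := card_union_le U {w', p, y}; omega)) x hx q hq
    refine ⟨z, hz, ?_, ?_, h'⟩
    · simp only [mem_union, mem_insert, not_or] at hzU ⊢
      tauto
    · rintro rfl
      simp at hzU
  obtain ⟨U, x, hU, hx, hc, hR, hF⟩ := PathTo.exists_blocks hw
    (by simp [hww', hwp, hyw.symm]) hl₀ hblock' hlink' k s hs hM (by omega)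
  obtain ⟨z, hzX, hz, hzp, hxz, hzp'⟩ := hlink' U (by omega) x hx p hp
  simp only [mem_union, not_or] at hz
  have hUF := Finset.disjoint_right.1 hF
  obtain ⟨U', hU', hpU', hc', -, hR', hF', hsub'⟩ :=
      hU.link hxz hzp' hF hz.1.1 hz.1.2 hz.2 hzp (hUF (by simp)) (by omega)
  have hUF' := Finset.disjoint_right.1 hF'
  have hw'U' : w' ∉ insert p U' := by
    simp only [mem_insert, not_or]
    exact ⟨hpw'.ne', hUF' (by simp)⟩
  refine ⟨_, hU'.step hpw' hw'U', ?_, ?_⟩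
  · rw [card_insert_of_notMem hw'U', card_insert_of_notMem hpU']; omega
  · simp only [mem_insert, not_or]
    exact ⟨hyw', hyp, hUF' (by simp)⟩

open Finset Classical in
/-- A small set hitting all but an exponentially small proportion of a family of large sets. -/
lemma exists_card_unhit_le {V ι : Type*} [Fintype V] [Nonempty V] (I : Finset ι)
    (f : ι → Finset V) (a : ℝ) (haV : a ≤ Fintype.card V) (hf : ∀ i ∈ I, a ≤ #(f i)) (j : ℕ) :
    ∃ R : Finset V, #R ≤ j ∧
      (#{i ∈ I | Disjoint (f i) R} : ℝ) ≤ #I * (1 - a / Fintype.card V) ^ j := by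
  have hN : (0 : ℝ) < Fintype.card V := by exact_mod_cast Fintype.card_pos
  have hq : 0 ≤ 1 - a / Fintype.card V := by
    rw [sub_nonneg, div_le_one hN]; exact haV
  induction j with
  | zero => exact ⟨∅, by simp⟩
  | succ j ih =>
    obtain ⟨R, hR, hRI⟩ := ih
    set I' : Finset ι := {i ∈ I | Disjoint (f i) R} with hI'
    obtain ⟨v, -, hv⟩ : ∃ v ∈ (univ : Finset V),
        a / Fintype.card V * #I' ≤ (#{i ∈ I' | v ∈ f i} : ℝ) := by
      refine exists_le_of_sum_le univ_nonempty ?_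
      have hcomm := sum_card_bipartiteAbove_eq_sum_card_bipartiteBelow (s := I')
        (t := (univ : Finset V)) (fun i v => v ∈ f i)
      simp only [bipartiteAbove, bipartiteBelow, filter_mem_eq_inter, univ_inter] at hcomm
      rw [sum_const, card_univ, nsmul_eq_mul, ← Nat.cast_sum, ← hcomm, Nat.cast_sum,
        ← mul_assoc, mul_div_cancel₀ _ hN.ne']
      calc a * #I' = ∑ i ∈ I', a := by rw [sum_const, nsmul_eq_mul, mul_comm]
        _ ≤ _ := sum_le_sum fun i hi => hf i (mem_filter.1 hi).1
    refine ⟨insert v R, (card_insert_le _ _).trans (by omega), ?_⟩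
    have hsplit := card_filter_add_card_filter_not (s := I') (fun i => v ∈ f i)
    have heq : ({i ∈ I | Disjoint (f i) (insert v R)} : Finset ι) = {i ∈ I' | v ∉ f i} := by
      ext i
      simp only [hI', mem_filter, disjoint_insert_right]
      tauto
    rw [heq, pow_succ, ← mul_assoc]
    have h1 : (#{i ∈ I' | v ∈ f i} : ℝ) + #{i ∈ I' | v ∉ f i} = #I' := by exact_mod_cast hsplit
    have h2 := mul_le_mul_of_nonneg_right hRI hq
    nlinarith

open Finset Classical in
/-- A small set meeting every member of a family of large sets in at least `k` points. -/
lemma exists_hitting_many {V ι : Type*} [Fintype V] [Nonempty V] (I : Finset ι)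
    (f : ι → Finset V) (a : ℝ) (haV : a ≤ Fintype.card V) (j k : ℕ)
    (hf : ∀ i ∈ I, a + k * j ≤ #(f i)) (hj : (#I : ℝ) * (1 - a / Fintype.card V) ^ j < 1) :
    ∃ R : Finset V, #R ≤ k * j ∧ ∀ i ∈ I, k ≤ #(R ∩ f i) := by
  induction k with
  | zero => exact ⟨∅, by simp⟩
  | succ k ih =>
    obtain ⟨R, hR, hRI⟩ := ih fun i hi => by
      have := hf i hi; push_cast at this; nlinarith [(Nat.cast_nonneg j : (0 : ℝ) ≤ j)]
    obtain ⟨R', hR', hRI'⟩ := exists_card_unhit_le I (fun i => f i \ R) a haV (fun i hi => by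
      have h1 := hf i hi
      have h2 : (#(f i) : ℝ) ≤ #(f i \ R) + #R := by
        exact_mod_cast Nat.sub_le_iff_le_add.1 (le_card_sdiff R (f i))
      have h3 : (#R : ℝ) ≤ k * j := by exact_mod_cast hR
      push_cast at h1
      nlinarith [(Nat.cast_nonneg j : (0 : ℝ) ≤ j)]) j
    have h0 : #{i ∈ I | Disjoint (f i \ R) R'} = 0 := by
      have := hRI'.trans_lt hj
      exact_mod_cast Nat.lt_one_iff.1 (by exact_mod_cast this)
    refine ⟨R ∪ R', (card_union_le _ _).trans (by rw [Nat.add_mul]; omega), fun i hi => ?_⟩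
    have h1 := filter_eq_empty_iff.1 (card_eq_zero.1 h0) hi
    rw [not_disjoint_iff] at h1
    obtain ⟨v, hv, hvR'⟩ := h1
    rw [mem_sdiff] at hv
    calc k + 1 ≤ #(insert v (R ∩ f i)) := by
          rw [card_insert_of_notMem (by simp [hv.2])]
          exact Nat.succ_le_succ (hRI i hi)
      _ ≤ _ := card_le_card (insert_subset (by simp [hv.1, hvR'])
          (inter_subset_inter_right subset_union_left))

open Finset Classical in
/-- In a dense relation some two distinct left vertices have many common partners. -/
lemma exists_pair_common {α β : Type*} [Fintype α] [Fintype β] [Nonempty β] (P : α → β → Prop)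
    (c : ℝ) (hc : 0 ≤ c) (hα : 2 < c ^ 2 * Fintype.card α)
    (h : c * Fintype.card α * Fintype.card β ≤ ∑ a, (#{b | P a b} : ℝ)) :
    ∃ a a', a ≠ a' ∧ c ^ 2 / 2 * Fintype.card β ≤ (#{b | P a b ∧ P a' b} : ℝ) := by
  by_contra! hcon
  set N : ℝ := (Fintype.card α : ℝ) with hN
  set M : ℝ := (Fintype.card β : ℝ) with hM
  have hM0 : 0 < M := by rw [hM]; exact_mod_cast Fintype.card_pos
  have hN0 : 0 < N := by
    have : (0 : ℝ) ≤ N := Nat.cast_nonneg _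
    rcases this.eq_or_lt with h0 | h0
    · rw [← h0] at hα; norm_num at hα
    · exact h0
  have hdeg : ∑ a, (#{b | P a b} : ℝ) = ∑ b, (#{a | P a b} : ℝ) := by
    exact_mod_cast sum_card_bipartiteAbove_eq_sum_card_bipartiteBelow (s := univ) (t := univ) P
  have hpairs : ∑ b, (#{a | P a b} : ℝ) ^ 2 = ∑ a, ∑ a', (#{b | P a b ∧ P a' b} : ℝ) := by
    simp only [card_filter, Nat.cast_sum, sq, sum_mul_sum]
    rw [sum_comm]
    refine sum_congr rfl fun a _ => ?_
    rw [sum_comm]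
    refine sum_congr rfl fun a' _ => sum_congr rfl fun b _ => ?_
    by_cases h1 : P a b <;> by_cases h2 : P a' b <;> simp [h1, h2]
  have hcs : (∑ b, (#{a | P a b} : ℝ)) ^ 2 ≤ M * ∑ b, (#{a | P a b} : ℝ) ^ 2 := by
    simpa [hM] using sq_sum_le_card_mul_sum_sq (s := (univ : Finset β))
      (f := fun b => (#{a | P a b} : ℝ))
  have hub : ∑ a, ∑ a', (#{b | P a b ∧ P a' b} : ℝ) ≤ ∑ a : α, ∑ a' : α,
      ((if a = a' then M else 0) + c ^ 2 / 2 * M) := by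
    refine sum_le_sum fun a _ => sum_le_sum fun a' _ => ?_
    split_ifs with haa
    · have : (#{b | P a b ∧ P a' b} : ℝ) ≤ M := by
        rw [hM]; exact_mod_cast card_le_univ _
      nlinarith [mul_nonneg (sq_nonneg c) hM0.le]
    · simpa using (hcon a a' haa).le
  simp only [sum_add_distrib, sum_ite_eq, mem_univ, if_true, sum_const, card_univ,
    nsmul_eq_mul] at hub
  have h3 : (c * N * M) ^ 2 ≤ (∑ b, (#{a | P a b} : ℝ)) ^ 2 := by
    rw [← hdeg]
    exact pow_le_pow_left₀ (by positivity) h 2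
  have h4 : (c * N * M) ^ 2 ≤ M * (N * M + N * (N * (c ^ 2 / 2 * M))) := by
    refine h3.trans (hcs.trans ?_)
    rw [hpairs]
    exact mul_le_mul_of_nonneg_left hub hM0.le
  have h5 : N * M ^ 2 * (c ^ 2 * N) ≤ N * M ^ 2 * 2 := by nlinarith
  have := le_of_mul_le_mul_left h5 (by positivity)
  linarith

open Finset Classical in
/-- A dense ternary relation contains a `2 × 2 × 2` box. -/
lemma exists_box {V : Type*} [Fintype V] [Nonempty V] (T : V → V → V → Prop) (c : ℝ) (hc : 0 ≤ c)
    (hc1 : 2 < c ^ 2 * Fintype.card V) (hc2 : 8 < c ^ 4 * Fintype.card V)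
    (h : c * Fintype.card V ^ 3 ≤ ∑ v, (#{e : V × V | T v e.1 e.2} : ℝ)) :
    ∃ u₁ u₁' u₂ u₂' u₃ u₃', u₁ ≠ u₁' ∧ u₂ ≠ u₂' ∧ u₃ ≠ u₃' ∧
      ∀ w₁, (w₁ = u₁ ∨ w₁ = u₁') → ∀ w₂, (w₂ = u₂ ∨ w₂ = u₂') → ∀ w₃, (w₃ = u₃ ∨ w₃ = u₃') →
        T w₁ w₂ w₃ := by
  obtain ⟨u₁, u₁', h₁, hcard⟩ := exists_pair_common (fun v (e : V × V) => T v e.1 e.2) c hc hc1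
    (by rw [Fintype.card_prod]; push_cast; nlinarith)
  have hsum : ((#{e : V × V | T u₁ e.1 e.2 ∧ T u₁' e.1 e.2} : ℕ) : ℝ)
      = ∑ a, (#{b | T u₁ a b ∧ T u₁' a b} : ℝ) := by
    simp only [card_filter, Nat.cast_sum]
    rw [Fintype.sum_prod_type]
  rw [Fintype.card_prod, hsum] at hcard
  push_cast at hcard
  obtain ⟨u₂, u₂', h₂, hcard₂⟩ := exists_pair_common (fun a b => T u₁ a b ∧ T u₁' a b) (c ^ 2 / 2)
    (by positivity) (by nlinarith) (by rw [mul_assoc]; convert hcard)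
  have hN1 : (1 : ℝ) < c ^ 4 / 8 * Fintype.card V := by linarith
  have h1 : 1 < #{b | (T u₁ u₂ b ∧ T u₁' u₂ b) ∧ T u₁ u₂' b ∧ T u₁' u₂' b} := by
    have h8 : c ^ 4 / 8 * (Fintype.card V : ℝ) = (c ^ 2 / 2) ^ 2 / 2 * Fintype.card V := by ring
    have h9 := (h8 ▸ hN1).trans_le hcard₂
    rw [Nat.one_lt_cast] at h9
    convert h9
  obtain ⟨u₃, hu₃, u₃', hu₃', h₃⟩ := one_lt_card.1 h1
  simp only [mem_filter, mem_univ, true_and] at hu₃ hu₃'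
  refine ⟨u₁, u₁', u₂, u₂', u₃, u₃', h₁, h₂, h₃, ?_⟩
  rintro w₁ (rfl | rfl) w₂ (rfl | rfl) w₃ (rfl | rfl) <;> tauto

open Finset in
/-- An averaging argument: some term has a large `g` and a small `q`. -/
lemma exists_large_of_sum_le {V : Type*} {S : Finset V} {n : ℝ} {g q : V → ℝ}
    (hn : 0 < n) (hS : S.Nonempty) (hgS : ∀ t, g t ≤ #S) (hq0 : ∀ t, 0 ≤ q t)
    (hg : 2510 / 10000 * n * #S ≤ ∑ t ∈ S, g t) (hq : ∑ t ∈ S, q t ≤ 1 / 10 ^ 12 * n ^ 3) :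
    ∃ t ∈ S, 2506 / 10000 * n ≤ g t ∧ q t ≤ 1 / 10 ^ 8 * n ^ 2 := by
  by_contra! hcon
  have hS0 : (0 : ℝ) < #S := by exact_mod_cast hS.card_pos
  have hn2 : 0 < 1 / 10 ^ 8 * n ^ 2 := by positivity
  have hle : ∀ t ∈ S, g t * (1 / 10 ^ 8 * n ^ 2) ≤
      2506 / 10000 * n * (1 / 10 ^ 8 * n ^ 2) + #S * q t := by
    intro t htS
    by_cases hgt : 2506 / 10000 * n ≤ g t
    · have h1 := (hcon t htS hgt).le
      have h3 := mul_le_mul (hgS t) h1 hn2.le hS0.le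
      have : 0 ≤ 2506 / 10000 * n * (1 / 10 ^ 8 * n ^ 2) := by positivity
      linarith
    · have h1 := mul_le_mul_of_nonneg_right (not_le.1 hgt).le hn2.le
      have := mul_nonneg hS0.le (hq0 t)
      linarith
  have hsum := sum_le_sum hle
  rw [← sum_mul, sum_add_distrib, sum_const, nsmul_eq_mul, ← mul_sum S q] at hsum
  have h1 := mul_le_mul_of_nonneg_left hq hS0.le
  have h4 := mul_le_mul_of_nonneg_right hg hn2.le
  have h5 : 0 < #S * n ^ 3 := by positivity
  nlinarith

open Finset Classical in
/-- Dependent choice: inside a suitable neighbourhood, almost all pairs of vertices are linked. -/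
lemma exists_linked_set {V : Type*} [Fintype V] (H : SimpleGraph V) (S : Finset V) (n : ℝ)
    (hn : 0 < n) (hS : S.Nonempty) (hHS : ∀ x y, H.Adj x y → x ∈ S)
    (hSn : (#S : ℝ) ≤ 301 / 100 * n)
    (hdeg : 482 / 1000 * n * #S ≤ ∑ x ∈ S, (#{y | H.Adj x y} : ℝ)) (Lk : V → V → Prop)
    (hLk : ∀ x z, ¬ Lk x z → (#{a | H.Adj x a ∧ H.Adj z a} : ℝ) ≤ 1 / 10 ^ 13 * n) :
    ∃ X : Finset V, 2505 / 10000 * n ≤ #X ∧ (∀ x ∈ X, 2502 / 10000 * n ≤ #{y | H.Adj x y}) ∧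
      ∀ x ∈ X, (#{z ∈ X | ¬ Lk x z} : ℝ) ≤ 1 / 10 ^ 4 * n := by
  set B : Finset V := {x ∈ S | 2502 / 10000 * n ≤ (#{y | H.Adj x y} : ℝ)} with hB
  have hS0 : (0 : ℝ) < #S := by exact_mod_cast hS.card_pos
  have hBS : (#B : ℝ) ≤ #S := by exact_mod_cast card_le_card (filter_subset _ _)
  have hdegS : ∀ x, (#{y | H.Adj x y} : ℝ) ≤ #S := fun x => by
    have : ({y | H.Adj x y} : Finset V) ⊆ S := fun y hy =>
      hHS y x (by simpa using hy : H.Adj x y).symm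
    exact_mod_cast card_le_card this
  -- the degree sum over `B`
  have hsplit : ∑ x ∈ S, (#{y | H.Adj x y} : ℝ) ≤
      ∑ x ∈ B, (#{y | H.Adj x y} : ℝ) + 2502 / 10000 * n * (#S - #B) := by
    rw [← sum_filter_add_sum_filter_not S (fun x => 2502 / 10000 * n ≤ (#{y | H.Adj x y} : ℝ))]
    have h1 := card_filter_add_card_filter_not (s := S)
      (fun x => 2502 / 10000 * n ≤ (#{y | H.Adj x y} : ℝ))
    have h2 : (#B : ℝ) + #{x ∈ S | ¬ 2502 / 10000 * n ≤ (#{y | H.Adj x y} : ℝ)} = #S := by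
      exact_mod_cast h1
    have h3 : ∑ x ∈ S with ¬ 2502 / 10000 * n ≤ (#{y | H.Adj x y} : ℝ), (#{y | H.Adj x y} : ℝ) ≤
        ∑ x ∈ S with ¬ 2502 / 10000 * n ≤ (#{y | H.Adj x y} : ℝ), 2502 / 10000 * n :=
      sum_le_sum fun x hx => (not_le.1 (mem_filter.1 hx).2).le
    rw [sum_const, nsmul_eq_mul] at h3
    rw [← hB]
    have h4 : (#S : ℝ) - #B = #{x ∈ S | ¬ 2502 / 10000 * n ≤ (#{y | H.Adj x y} : ℝ)} := by
      linarith
    rw [h4]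
    linarith
  have hBdeg : ∑ x ∈ B, (#{y | H.Adj x y} : ℝ) ≤ #B * #S := by
    rw [← nsmul_eq_mul]
    exact sum_le_card_nsmul _ _ _ fun x _ => hdegS x
  have hBn : 2318 / 10000 * n ≤ #B := by
    have : 2318 / 10000 * n * #S ≤ #B * #S := by
      nlinarith [mul_nonneg hn.le (Nat.cast_nonneg #B : (0 : ℝ) ≤ #B)]
    exact le_of_mul_le_mul_right this hS0
  have hBsum : 2510 / 10000 * n * #S ≤ ∑ x ∈ B, (#{y | H.Adj x y} : ℝ) := by
    nlinarith [mul_le_mul_of_nonneg_left hBn hn.le, mul_le_mul_of_nonneg_left hSn hn.le]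
  -- double counting
  have hg : ∑ t ∈ S, (#{x ∈ B | H.Adj t x} : ℝ) = ∑ x ∈ B, (#{y | H.Adj x y} : ℝ) := by
    have := sum_card_bipartiteAbove_eq_sum_card_bipartiteBelow (s := S) (t := B) H.Adj
    simp only [bipartiteAbove, bipartiteBelow] at this
    rw [← Nat.cast_sum, this, Nat.cast_sum]
    refine sum_congr rfl fun x _ => ?_
    congr 2
    ext y
    simp only [mem_filter, mem_univ, true_and]
    exact ⟨fun h => h.2.symm, fun h => ⟨hHS _ _ h.symm, h.symm⟩⟩
  have hq : ∑ t ∈ S, ((∑ x ∈ B with H.Adj t x, #{z ∈ B | H.Adj t z ∧ ¬ Lk x z} : ℕ) : ℝ) ≤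
      #B * #B * (1 / 10 ^ 13 * n) := by
    calc ∑ t ∈ S, ((∑ x ∈ B with H.Adj t x, #{z ∈ B | H.Adj t z ∧ ¬ Lk x z} : ℕ) : ℝ)
        = ∑ x ∈ B, ∑ z ∈ B, ∑ t ∈ S, (if H.Adj t x ∧ H.Adj t z ∧ ¬ Lk x z then (1 : ℝ) else 0) := by
          rw [sum_congr rfl fun x _ => sum_comm, sum_comm]
          refine sum_congr rfl fun t _ => ?_
          push_cast
          rw [sum_filter]
          refine sum_congr rfl fun x _ => ?_
          by_cases h : H.Adj t x <;> simp [h]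
      _ ≤ ∑ x ∈ B, ∑ z ∈ B, 1 / 10 ^ 13 * n := by
          refine sum_le_sum fun x _ => sum_le_sum fun z _ => ?_
          by_cases h : Lk x z
          · simp only [h, not_true_eq_false, and_false, if_false, sum_const_zero]
            positivity
          · refine le_trans ?_ (hLk x z h)
            simp only [h, not_false_eq_true, and_true]
            rw [sum_boole]
            norm_cast
            refine card_le_card fun t ht => ?_
            simp only [mem_filter, mem_univ, true_and] at ht ⊢
            exact ⟨ht.2.1.symm, ht.2.2.symm⟩
      _ = _ := by simp only [sum_const, nsmul_eq_mul]; ring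
  obtain ⟨t, -, ht, htq⟩ : ∃ t ∈ S, 2506 / 10000 * n ≤ (#{x ∈ B | H.Adj t x} : ℝ) ∧
      ((∑ x ∈ B with H.Adj t x, #{z ∈ B | H.Adj t z ∧ ¬ Lk x z} : ℕ) : ℝ) ≤ 1 / 10 ^ 8 * n ^ 2 := by
    refine exists_large_of_sum_le hn hS (fun t => ?_) (fun t => Nat.cast_nonneg _)
      (hg ▸ hBsum) (hq.trans ?_)
    · exact (Nat.cast_le.2 (card_le_card (filter_subset _ _))).trans hBS
    · have h2 : (#B : ℝ) * #B ≤ (301 / 100 * n) * (301 / 100 * n) :=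
        mul_le_mul (hBS.trans hSn) (hBS.trans hSn) (by positivity) (by positivity)
      calc (#B : ℝ) * #B * (1 / 10 ^ 13 * n)
          ≤ (301 / 100 * n) * (301 / 100 * n) * (1 / 10 ^ 13 * n) := by gcongr
        _ ≤ 1 / 10 ^ 12 * n ^ 3 := by
          have : 0 < n ^ 3 := by positivity
          nlinarith
  set A : Finset V := {x ∈ B | H.Adj t x} with hA
  set X : Finset V := {x ∈ A | (#{z ∈ B | H.Adj t z ∧ ¬ Lk x z} : ℝ) ≤ 1 / 10 ^ 4 * n} with hX
  refine ⟨X, ?_, fun x hx => ?_, fun x hx => ?_⟩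
  · have h1 : #X + #{x ∈ A | ¬ (#{z ∈ B | H.Adj t z ∧ ¬ Lk x z} : ℝ) ≤ 1 / 10 ^ 4 * n} = #A :=
      card_filter_add_card_filter_not _
    have h2 : (#X : ℝ) + (#{x ∈ A | ¬ (#{z ∈ B | H.Adj t z ∧ ¬ Lk x z} : ℝ) ≤ 1 / 10 ^ 4 * n} : ℕ)
        = #A := by rw [← h1, Nat.cast_add]
    have h3 : (#{x ∈ A | ¬ (#{z ∈ B | H.Adj t z ∧ ¬ Lk x z} : ℝ) ≤ 1 / 10 ^ 4 * n} : ℝ) *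
        (1 / 10 ^ 4 * n) ≤ 1 / 10 ^ 8 * n ^ 2 := by
      refine le_trans ?_ htq
      rw [← nsmul_eq_mul, Nat.cast_sum]
      refine (card_nsmul_le_sum _ _ _ fun x hx => (not_le.1 (mem_filter.1 hx).2).le).trans ?_
      exact sum_le_sum_of_subset_of_nonneg (filter_subset _ _) fun _ _ _ => Nat.cast_nonneg _
    have h4 : (#{x ∈ A | ¬ (#{z ∈ B | H.Adj t z ∧ ¬ Lk x z} : ℝ) ≤ 1 / 10 ^ 4 * n} : ℝ) ≤
        1 / 10 ^ 4 * n :=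
      le_of_mul_le_mul_right (a := 1 / 10 ^ 4 * n) (h3.trans (le_of_eq (by ring))) (by positivity)
    linarith
  · exact (mem_filter.1 (mem_filter.1 (mem_filter.1 hx).1).1).2
  · refine le_trans ?_ (mem_filter.1 hx).2
    norm_cast
    refine card_le_card fun z hz => ?_
    simp only [hX, hA, mem_filter] at hz ⊢
    tauto

open Finset Classical in
/-- A large set of vertices of large degree contains, outside any not too large set, a nonempty
bipartite piece of linear minimum degree. -/
lemma exists_block {V : Type*} [Fintype V] (H : SimpleGraph V) (X R : Finset V) (n : ℝ) (d : ℕ)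
    (hV : (Fintype.card V : ℝ) ≤ 301 / 100 * n) (hn : 0 < n) (hd : (d : ℝ) ≤ 5 / 10 ^ 9 * n)
    (hX : 2505 / 10000 * n ≤ #X) (hXdeg : ∀ x ∈ X, 2502 / 10000 * n ≤ #{y | H.Adj x y})
    (hR : (#R : ℝ) ≤ 5 / 10 ^ 5 * n) (U : Finset V) (hU : (#U : ℝ) ≤ 1 / 4 * n) :
    ∃ A ⊆ X, ∃ B, A.Nonempty ∧ Disjoint (A ∪ B) (U ∪ R) ∧
      (∀ a ∈ A, d ≤ #{b ∈ B | H.Adj a b}) ∧ ∀ b ∈ B, d ≤ #{a ∈ A | H.Adj a b} := by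
  have hUR : (#(U ∪ R) : ℝ) ≤ 25005 / 100000 * n := by
    have : (#(U ∪ R) : ℝ) ≤ #U + #R := by exact_mod_cast card_union_le U R
    linarith
  have hA0 : 4 / 10 ^ 4 * n ≤ (#(X \ (U ∪ R)) : ℝ) := by
    have : (#X : ℝ) ≤ #(X \ (U ∪ R)) + #(U ∪ R) := by
      exact_mod_cast Nat.sub_le_iff_le_add.1 (le_card_sdiff (U ∪ R) X)
    linarith
  have hdeg : ∀ a ∈ X \ (U ∪ R),
      1 / 10 ^ 4 * n ≤ (#{b ∈ univ \ (U ∪ R) | H.Adj a b} : ℝ) := by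
    intro a ha
    have h1 : ({y | H.Adj a y} : Finset V) ⊆ {b ∈ univ \ (U ∪ R) | H.Adj a b} ∪ (U ∪ R) := by
      intro y hy
      simp only [mem_filter, mem_univ, true_and, mem_union, mem_sdiff] at hy ⊢
      tauto
    have h2 : (#{y | H.Adj a y} : ℝ) ≤ #{b ∈ univ \ (U ∪ R) | H.Adj a b} + #(U ∪ R) := by
      exact_mod_cast (card_le_card h1).trans (card_union_le _ _)
    have h3 := hXdeg a (mem_sdiff.1 ha).1
    linarith
  have hsum : (#(X \ (U ∪ R)) : ℝ) * (1 / 10 ^ 4 * n) ≤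
      ∑ a ∈ X \ (U ∪ R), (#{b ∈ univ \ (U ∪ R) | H.Adj a b} : ℝ) := by
    rw [← nsmul_eq_mul]
    exact card_nsmul_le_sum _ _ _ hdeg
  obtain ⟨A, hA, B, hB, hne, h⟩ := exists_minDegree_subpair H.Adj d (X \ (U ∪ R)) (univ \ (U ∪ R))
    (by
      have h1 : (#(X \ (U ∪ R)) : ℝ) ≤ 301 / 100 * n :=
        (Nat.cast_le.2 (card_le_univ _)).trans hV
      have h2 : (#(univ \ (U ∪ R)) : ℝ) ≤ 301 / 100 * n :=
        (Nat.cast_le.2 (card_le_univ _)).trans hV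
      have h3 : (d : ℝ) * (#(X \ (U ∪ R)) + #(univ \ (U ∪ R))) ≤
          5 / 10 ^ 9 * n * (602 / 100 * n) :=
        mul_le_mul hd (by linarith) (by positivity) (by positivity)
      have h4 : 4 / 10 ^ 4 * n * (1 / 10 ^ 4 * n) ≤
          (#(X \ (U ∪ R)) : ℝ) * (1 / 10 ^ 4 * n) :=
        mul_le_mul_of_nonneg_right hA0 (by positivity)
      have h5 : 0 < n * n := by positivity
      have h6 : (d : ℝ) * (#(X \ (U ∪ R)) + #(univ \ (U ∪ R))) <
          ∑ a ∈ X \ (U ∪ R), (#{b ∈ univ \ (U ∪ R) | H.Adj a b} : ℝ) := by nlinarith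
      exact_mod_cast h6)
  refine ⟨A, hA.trans sdiff_subset, B, hne, ?_, h⟩
  exact disjoint_of_subset_left (union_subset (hA.trans (sdiff_subset_sdiff (subset_univ _)
    subset_rfl)) hB) sdiff_disjoint

open Finset Classical in
/-- Any two vertices of `X` have a common linked vertex outside a not too large set. -/
lemma exists_common_linked {V : Type*} [Fintype V] (H : SimpleGraph V) (X R : Finset V) (n : ℝ)
    (h : ℕ) (hn : 0 < n) (hX : 2505 / 10000 * n ≤ #X)
    (hlk : ∀ x ∈ X, (#{z ∈ X | ¬ Linked H R h x z} : ℝ) ≤ 1 / 10 ^ 4 * n)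
    (hR : (#R : ℝ) ≤ 5 / 10 ^ 5 * n) (U : Finset V) (hU : (#U : ℝ) ≤ 1 / 4 * n)
    (x : V) (hx : x ∈ X) (p : V) (hp : p ∈ X) :
    ∃ z ∈ X, z ∉ U ∪ R ∧ Linked H R h x z ∧ Linked H R h z p := by
  by_contra! hcon
  have hsub : X ⊆ U ∪ R ∪ ({z ∈ X | ¬ Linked H R h x z} ∪ {z ∈ X | ¬ Linked H R h p z}) := by
    intro z hz
    have h1 := hcon z hz
    have h2 : Linked H R h p z → Linked H R h z p := fun h3 => by
      simpa only [Linked, and_comm] using h3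
    rw [mem_union]
    by_cases hzU : z ∈ U ∪ R
    · exact .inl hzU
    · simp only [mem_union, mem_filter]
      tauto
  have h1 := (card_le_card hsub).trans (card_union_le _ _)
  have h2 := card_union_le U R
  have h3 := card_union_le ({z ∈ X | ¬ Linked H R h x z}) {z ∈ X | ¬ Linked H R h p z}
  have h4 : (#X : ℝ) ≤ #U + #R + (#{z ∈ X | ¬ Linked H R h x z} +
      #{z ∈ X | ¬ Linked H R h p z}) := by exact_mod_cast h1.trans (add_le_add h2 h3)
  linarith [hlk x hx, hlk p hp]

open Finset Classical in
/-- Counting edges that leave a set of vertices of large degree and end in a vertex with at least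
three neighbours in that set. -/
lemma many_edges_to_rich {V : Type*} [Fintype V] (H : SimpleGraph V) (X : Finset V) (n : ℝ)
    (hV : (Fintype.card V : ℝ) ≤ 301 / 100 * n) (hn : 3000 ≤ n)
    (hX : 2505 / 10000 * n ≤ #X) (hXdeg : ∀ x ∈ X, 2502 / 10000 * n ≤ #{y | H.Adj x y}) :
    6 / 100 * n ^ 2 ≤
      (#{e : V × V | e.1 ∈ X ∧ H.Adj e.1 e.2 ∧ 3 ≤ #{x ∈ X | H.Adj x e.2}} : ℝ) := by
  have h1 : (#X : ℝ) * (2502 / 10000 * n) ≤ ∑ x ∈ X, (#{y | H.Adj x y} : ℝ) := by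
    rw [← nsmul_eq_mul]
    exact card_nsmul_le_sum _ _ _ hXdeg
  have h2 : ∑ x ∈ X, #{y | H.Adj x y} ≤
      #{e : V × V | e.1 ∈ X ∧ H.Adj e.1 e.2 ∧ 3 ≤ #{x ∈ X | H.Adj x e.2}} +
        2 * Fintype.card V := by
    have h3 : ∑ x ∈ X, #{y | H.Adj x y} = #{e : V × V | e.1 ∈ X ∧ H.Adj e.1 e.2} := by
      simp only [card_filter]
      rw [Fintype.sum_prod_type, ← sum_subset (subset_univ X) fun x _ hx => by simp [hx]]
      exact sum_congr rfl fun x hx => by simp [hx]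
    have h4 : #{e : V × V | e.1 ∈ X ∧ H.Adj e.1 e.2 ∧ ¬ 3 ≤ #{x ∈ X | H.Adj x e.2}} ≤
        2 * Fintype.card V := by
      refine card_le_mul_card_image_of_maps_to (f := Prod.snd) (t := univ) (by simp) 2
        fun y _ => ?_
      by_cases hy : 3 ≤ #{x ∈ X | H.Adj x y}
      · rw [card_eq_zero.2]
        · simp
        · ext e
          simp only [mem_filter, mem_univ, true_and, notMem_empty, iff_false]
          rintro ⟨h, rfl⟩
          exact h.2.2 hy
      · refine (card_le_card_of_injOn Prod.fst (t := {x ∈ X | H.Adj x y}) ?_ ?_).trans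
          (by omega)
        · intro e he
          simp only [coe_filter, mem_filter, mem_univ, true_and, Set.mem_ofPred_eq] at he ⊢
          exact ⟨he.1.1, he.2 ▸ he.1.2.1⟩
        · intro e he e' he' h
          simp only [coe_filter, mem_filter, mem_univ, true_and, Set.mem_ofPred_eq] at he he'
          exact Prod.ext h (he.2.trans he'.2.symm)
    rw [h3, ← card_filter_add_card_filter_not (fun e : V × V => 3 ≤ #{x ∈ X | H.Adj x e.2})]
    simp only [filter_filter, and_assoc]
    omega
  have h5 : ∑ x ∈ X, (#{y | H.Adj x y} : ℝ) ≤
      #{e : V × V | e.1 ∈ X ∧ H.Adj e.1 e.2 ∧ 3 ≤ #{x ∈ X | H.Adj x e.2}} +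
        2 * Fintype.card V := by exact_mod_cast h2
  nlinarith

open Finset Classical in
/-- Inside a dense neighbourhood, linearly many vertices with linked pairs give many edges
whose ends are joined by paths of a prescribed even order avoiding any given vertex. -/
lemma many_joined_pairs_of_linked {V : Type*} [Fintype V] (H : SimpleGraph V) (X R : Finset V)
    (n m h K : ℕ) (hV : (Fintype.card V : ℝ) ≤ 301 / 100 * n) (hn : 10 ^ 12 ≤ n)
    (hX : 2505 / 10000 * (n : ℝ) ≤ #X)
    (hXdeg : ∀ x ∈ X, 2502 / 10000 * (n : ℝ) ≤ #{y | H.Adj x y})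
    (hlk : ∀ x ∈ X, (#{z ∈ X | ¬ Linked H R h x z} : ℝ) ≤ 1 / 10 ^ 4 * (n : ℝ))
    (hR : (#R : ℝ) ≤ 5 / 10 ^ 5 * n) (hK : K = 10 ^ 8) (hh : 2 * K + 6 < h)
    (hm : Odd m) (hKm : 4 * K + 7 ≤ m) (hmn : 4 * m ≤ n) :
    6 / 100 * (n : ℝ) ^ 2 ≤ (#{e : V × V | H.Adj e.1 e.2 ∧ ∀ y, y ≠ e.1 → y ≠ e.2 →
      ∃ U, PathTo H e.1 U e.2 ∧ #U = m - 1 ∧ y ∉ U} : ℝ) := by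
  have hn' : (10 : ℝ) ^ 12 ≤ n := by exact_mod_cast hn
  have hn0 : (0 : ℝ) < n := by linarith
  refine (many_edges_to_rich H X n hV (by linarith) hX hXdeg).trans ?_
  norm_cast
  refine card_le_card fun e he => ?_
  simp only [mem_filter, mem_univ, true_and] at he ⊢
  obtain ⟨he1, he2, he3⟩ := he
  refine ⟨he2, fun y hy1 hy2 => ?_⟩
  obtain ⟨p, hp, hp'⟩ := exists_mem_notMem_of_card_lt_card
    ((card_le_two (a := e.1) (b := y)).trans_lt he3)
  simp only [mem_filter, mem_insert, mem_singleton, not_or] at hp hp'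
  obtain ⟨r, hr⟩ := hm
  have hcard : ∀ U : Finset V, #U ≤ m → (#U : ℝ) ≤ 1 / 4 * n := fun U hU => by
    have h1 : (#U : ℝ) ≤ m := by exact_mod_cast hU
    have h2 : 4 * (m : ℝ) ≤ n := by exact_mod_cast hmn
    linarith
  have hd : ((n / (2 * 10 ^ 8) : ℕ) : ℝ) ≤ 5 / 10 ^ 9 * n := by
    refine Nat.cast_div_le.trans (le_of_eq ?_)
    push_cast
    ring
  obtain ⟨U, hU, hUc, hyU⟩ := PathTo.exists_avoiding (l₀ := (n / (2 * 10 ^ 8) - 2) / 2)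
    (M := m - 6) (k := K) (s := (m - 7 - 4 * K) / 2) (R := R) (h := h) he1 hp.1 hp.2
    he2.ne (Ne.symm hp'.1) hy1 hy2 (Ne.symm hp'.2) (d := n / (2 * 10 ^ 8)) (by omega)
    (fun U hU => exists_block H X R n _ hV hn0 hd hX hXdeg hR U (hcard U (by omega)))
    (fun U hU => exists_common_linked H X R n h hn0 hX hlk hR U (hcard U (by omega)))
    (by subst hK; omega) (by omega) hh
  exact ⟨U, hU, by omega, hyU⟩

/-- A square times a decaying exponential in a linear exponent is eventually small. -/
lemma exists_forall_sq_mul_pow_lt_one : ∃ N₀ : ℕ, ∀ n ≥ N₀,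
    (301 / 100 * (n : ℝ)) ^ 2 * (1 - 1 / 10 ^ 14 : ℝ) ^ (n / 10 ^ 22) < 1 := by
  have h1 : Filter.Tendsto (fun j : ℕ => (j : ℝ) ^ 2 * (1 - 1 / 10 ^ 14 : ℝ) ^ j) Filter.atTop
      (nhds 0) :=
    tendsto_pow_const_mul_const_pow_of_abs_lt_one 2 (by norm_num [abs_of_nonneg])
  have h2 := h1.comp (Filter.tendsto_add_atTop_nat 1)
  have h3 := (h2.const_mul ((301 / 100 * 10 ^ 22) ^ 2 / (1 - 1 / 10 ^ 14 : ℝ))).eventually_lt_const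
    (u := 1) (by norm_num)
  obtain ⟨J, hJ⟩ := Filter.eventually_atTop.1 h3
  refine ⟨J * 10 ^ 22, fun n hn => ?_⟩
  have hj := hJ (n / 10 ^ 22) ((Nat.le_div_iff_mul_le (by norm_num)).2 hn)
  refine lt_of_le_of_lt ?_ hj
  have h4 : (n : ℝ) ≤ 10 ^ 22 * ((n / 10 ^ 22 + 1 : ℕ) : ℝ) := by
    exact_mod_cast (Nat.lt_mul_div_succ n (by norm_num)).le
  simp only [Function.comp]
  rw [pow_succ (1 - 1 / 10 ^ 14 : ℝ)]
  calc (301 / 100 * (n : ℝ)) ^ 2 * (1 - 1 / 10 ^ 14 : ℝ) ^ (n / 10 ^ 22)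
      ≤ (301 / 100 * (10 ^ 22 * ((n / 10 ^ 22 + 1 : ℕ) : ℝ))) ^ 2 *
          (1 - 1 / 10 ^ 14 : ℝ) ^ (n / 10 ^ 22) := by gcongr
    _ = _ := by field_simp

open Finset Classical in
/-- A neighbourhood `S` in which the graph `H` has average degree above `0.482 n` contains many
edges whose ends are joined by paths of `m - 1` vertices avoiding any given vertex. -/
lemma many_joined_pairs : ∃ N₀ : ℕ, ∀ (V : Type) [Fintype V] (H : SimpleGraph V) (S : Finset V)
    (n m : ℕ), N₀ ≤ n → Odd m → 4 * 10 ^ 8 + 7 ≤ m → 4 * m ≤ n →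
    (Fintype.card V = 3 * n + 4) → S.Nonempty → (∀ x y, H.Adj x y → x ∈ S) →
    482 / 1000 * (n : ℝ) * #S ≤ ∑ x ∈ S, (#{y | H.Adj x y} : ℝ) →
    6 / 100 * (n : ℝ) ^ 2 ≤ (#{e : V × V | H.Adj e.1 e.2 ∧ ∀ y, y ≠ e.1 → y ≠ e.2 →
      ∃ U, PathTo H e.1 U e.2 ∧ #U = m - 1 ∧ y ∉ U} : ℝ) := by
  obtain ⟨N₁, hN₁⟩ := exists_forall_sq_mul_pow_lt_one
  refine ⟨N₁ + 10 ^ 12, fun V _ H S n m hn hm hKm hmn hV hS hHS hdeg => ?_⟩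
  have hn' : (10 : ℝ) ^ 12 ≤ n := by exact_mod_cast (by omega : 10 ^ 12 ≤ n)
  have hn0 : (0 : ℝ) < n := by linarith
  have hVe : (Fintype.card V : ℝ) = 3 * n + 4 := by rw [hV]; push_cast; rfl
  have hV' : (Fintype.card V : ℝ) ≤ 301 / 100 * n := by linarith
  have : Nonempty V := ⟨hS.choose⟩
  obtain ⟨h, hh⟩ : ∃ h : ℕ, h = 3 * 10 ^ 8 := ⟨_, rfl⟩
  obtain ⟨j, hj⟩ : ∃ j : ℕ, j = n / 10 ^ 22 := ⟨_, rfl⟩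
  have hjn : (j : ℝ) ≤ n / 10 ^ 22 := by
    rw [hj]; exact Nat.cast_div_le.trans (le_of_eq (by norm_cast))
  have hhj : ((h * j : ℕ) : ℝ) ≤ 3 / 10 ^ 14 * n := by
    rw [hh]; push_cast; linarith
  obtain ⟨R, hRc, hR⟩ := exists_hitting_many
    ({e : V × V | 1 / 10 ^ 13 * (n : ℝ) ≤ (#{a | H.Adj e.1 a ∧ H.Adj e.2 a} : ℝ)})
    (fun e : V × V => ({a | H.Adj e.1 a ∧ H.Adj e.2 a} : Finset V)) (5 / 10 ^ 14 * n)
    (by linarith) j h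
    (fun e he => by
      have := (mem_filter.1 he).2
      push_cast at hhj
      linarith)
    (by
      refine lt_of_le_of_lt ?_ (hN₁ n (by omega))
      rw [hj]
      have h1 : (1 : ℝ) / 10 ^ 14 ≤ 5 / 10 ^ 14 * n / Fintype.card V := by
        rw [le_div_iff₀ (by linarith)]
        linarith
      have h2 : 5 / 10 ^ 14 * (n : ℝ) / Fintype.card V ≤ 1 := by
        rw [div_le_one (by linarith)]
        linarith
      have h3 : (#({e : V × V | 1 / 10 ^ 13 * (n : ℝ) ≤
          (#{a | H.Adj e.1 a ∧ H.Adj e.2 a} : ℝ)}) : ℝ) ≤ (301 / 100 * n) ^ 2 := by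
        refine (Nat.cast_le.2 (card_le_univ _)).trans ?_
        rw [Fintype.card_prod, sq]
        push_cast
        exact mul_le_mul hV' hV' (by positivity) (by positivity)
      have h4 : (0 : ℝ) ≤ 1 - 5 / 10 ^ 14 * n / Fintype.card V := by linarith
      gcongr)
  obtain ⟨X, hX, hXdeg, hlk⟩ := exists_linked_set H S n hn0 hS hHS
    ((Nat.cast_le.2 (card_le_univ S)).trans hV') hdeg (Linked H R h) (fun x z hxz => by
      by_contra! hcon
      refine hxz ((hR (x, z) (by simpa using hcon.le)).trans (card_le_card fun a ha => ?_))
      simpa using ha)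
  exact many_joined_pairs_of_linked H X R n m h (10 ^ 8) hV' (by omega) hX hXdeg hlk
    ((Nat.cast_le.2 hRc).trans (by linarith)) rfl (by omega) hm hKm hmn

/-- The graph induced by `G` on the neighbourhood of `v`, on the same vertex type. -/
def nbhdGraph {V : Type*} (G : SimpleGraph V) (v : V) : SimpleGraph V where
  Adj x y := G.Adj x y ∧ G.Adj v x ∧ G.Adj v y
  symm := ⟨fun _ _ h => ⟨h.1.symm, h.2.2, h.2.1⟩⟩
  loopless := ⟨fun _ h => h.1.ne rfl⟩

open Finset in
/-- Goodman's identity for a symmetric weight and its complement. -/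
lemma sum_complement_triangles {V : Type*} [Fintype V] (f : V → V → ℝ)
    (hf : ∀ x y, f x y = f y x) :
    ∑ v, ∑ x, ∑ y, (1 - f v x) * (1 - f x y) * (1 - f v y) =
      (Fintype.card V : ℝ) ^ 3 - 3 * Fintype.card V * ∑ x, ∑ y, f x y +
        3 * ∑ x, (∑ y, f x y) ^ 2 - ∑ v, ∑ x, ∑ y, f v x * f x y * f v y := by
  have e1 : ∑ v, ∑ x, ∑ y, f v x * f x y = ∑ x, (∑ y, f x y) ^ 2 := by
    rw [sum_comm]
    refine sum_congr rfl fun x _ => ?_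
    rw [sq, sum_mul_sum]
    simp only [hf _ x]
  have e2 : ∑ v, ∑ x, ∑ y, f v x * f v y = ∑ x, (∑ y, f x y) ^ 2 := by
    refine sum_congr rfl fun x _ => ?_
    rw [sq, sum_mul_sum]
  have e3 : ∑ v, ∑ x, ∑ y, f x y * f v y = ∑ x, (∑ y, f x y) ^ 2 := by
    rw [sum_congr rfl fun v _ => sum_comm, sum_comm]
    refine sum_congr rfl fun x _ => ?_
    rw [sq, sum_mul_sum]
    refine sum_congr rfl fun v _ => sum_congr rfl fun y _ => ?_
    rw [hf x v, hf x y, mul_comm]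
  have e4 : ∑ v, ∑ x, ∑ y : V, f v x = Fintype.card V * ∑ x, ∑ y, f x y := by
    simp only [sum_const, nsmul_eq_mul, ← mul_sum, card_univ]
  have e5 : ∑ v : V, ∑ x, ∑ y, f x y = Fintype.card V * ∑ x, ∑ y, f x y := by
    simp only [sum_const, nsmul_eq_mul, card_univ]
  have e6 : ∑ v, ∑ x : V, ∑ y, f v y = Fintype.card V * ∑ x, ∑ y, f x y := by
    simp only [sum_const, nsmul_eq_mul, ← mul_sum, card_univ]
  have e7 : ∑ v : V, ∑ x : V, ∑ y : V, (1 : ℝ) = (Fintype.card V : ℝ) ^ 3 := by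
    simp only [sum_const, nsmul_eq_mul, card_univ]; ring
  calc ∑ v, ∑ x, ∑ y, (1 - f v x) * (1 - f x y) * (1 - f v y)
      = ∑ v, ∑ x, ∑ y, (1 - f v x - f x y - f v y + f v x * f x y + f v x * f v y +
          f x y * f v y - f v x * f x y * f v y) := by
        refine sum_congr rfl fun v _ => sum_congr rfl fun x _ => sum_congr rfl fun y _ => ?_
        ring
    _ = _ := by
        simp only [sum_sub_distrib, sum_add_distrib]
        rw [e1, e2, e3, e4, e5, e6, e7]
        ring

/-- The numerical estimate behind the triangle count. -/
lemma triangle_count_estimate {t N F p Q : ℝ} (ht : 10 ^ 5 ≤ t) (hN : N = 3 * t + 4) (hp : F = p * N)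
    (hFN : F ≤ N * N) (hQ : F ^ 2 ≤ N * Q) :
    4 / 1000 * t ^ 2 * N ≤
      N ^ 3 - 3 * N * F + 3 * Q - (t + 2) * F - 482 / 1000 * t * (N * N - F) := by
  have hN0 : 0 < N := by linarith
  have hpN : p ≤ N := le_of_mul_le_mul_right (hp ▸ hFN) hN0
  have hQp : p ^ 2 * N ≤ Q := by
    refine le_of_mul_le_mul_left (le_trans (le_of_eq ?_) hQ) hN0
    rw [hp]; ring
  have hmain : 4 / 1000 * t ^ 2 ≤
      N ^ 2 - 3 * N * p + 3 * p ^ 2 - (t + 2) * p - 482 / 1000 * t * (N - p) := by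
    have h1 := sq_nonneg (p - 9518 / 6000 * t)
    have h2 : 0 ≤ (t - 10 ^ 5) * t := mul_nonneg (by linarith) (by linarith)
    rw [hN] at hpN ⊢
    nlinarith
  have h3 := mul_le_mul_of_nonneg_right hmain hN0.le
  rw [hp]
  nlinarith

open Finset Classical in
/-- If any two vertices have at most `n - 1` common neighbours, the complement has many triangles
relative to its number of edges. -/
lemma le_sum_compl_triangles {V : Type*} [Fintype V] (Γ : SimpleGraph V) (n : ℕ)
    (hn : 10 ^ 5 ≤ n) (hV : Fintype.card V = 3 * n + 4)
    (hco : ∀ u w, u ≠ w → #{y | Γ.Adj u y ∧ Γ.Adj w y} + 1 ≤ n) :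
    4 / 1000 * (n : ℝ) ^ 2 * Fintype.card V ≤
      ∑ v, ((∑ x with Γᶜ.Adj v x, #{y | (nbhdGraph Γᶜ v).Adj x y} : ℕ) -
        482 / 1000 * (n : ℝ) * #{x | Γᶜ.Adj v x}) := by
  set f : V → V → ℝ := fun x y => if Γᶜ.Adj x y then 0 else 1 with hf
  have hsym : ∀ x y, f x y = f y x := fun x y => by simp only [hf, Γᶜ.adj_comm]
  have h1f : ∀ x y, 1 - f x y = if Γᶜ.Adj x y then 1 else 0 := fun x y => by
    simp only [hf]; split_ifs <;> norm_num
  have htri : ∀ v, ((∑ x with Γᶜ.Adj v x, #{y | (nbhdGraph Γᶜ v).Adj x y} : ℕ) : ℝ) =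
      ∑ x, ∑ y, (1 - f v x) * (1 - f x y) * (1 - f v y) := by
    intro v
    simp only [h1f, card_filter]
    push_cast
    rw [sum_filter]
    refine sum_congr rfl fun x _ => ?_
    by_cases hx : Γᶜ.Adj v x
    · simp only [hx, if_true, nbhdGraph, one_mul, true_and]
      refine sum_congr rfl fun y _ => ?_
      by_cases h1 : Γᶜ.Adj x y <;> by_cases h2 : Γᶜ.Adj v y <;> simp only [h1, h2] <;> norm_num
    · simp only [hx, if_false, zero_mul, sum_const_zero]
  have hD : ∀ v, (#{x | Γᶜ.Adj v x} : ℝ) = Fintype.card V - ∑ y, f v y := by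
    intro v
    rw [← sum_boole, ← sum_congr rfl fun y _ => h1f v y, sum_sub_distrib]
    simp
  have hcommon : ∀ u w, u ≠ w → ∑ y, f u y * f w y ≤ n + 1 := by
    intro u w huw
    have h1 : ∑ y, f u y * f w y ≤
        (#(({y | Γ.Adj u y ∧ Γ.Adj w y} : Finset V) ∪ {u, w}) : ℝ) := by
      calc ∑ y, f u y * f w y
          ≤ ∑ y, if y ∈ ({y | Γ.Adj u y ∧ Γ.Adj w y} : Finset V) ∪ {u, w} then (1 : ℝ) else 0 := by
            refine sum_le_sum fun y _ => ?_
            split_ifs with hy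
            · simp only [hf]; split_ifs <;> norm_num
            · simp only [mem_union, mem_filter, mem_univ, true_and, mem_insert, mem_singleton,
                not_or] at hy
              have : Γᶜ.Adj u y ∨ Γᶜ.Adj w y := by
                simp only [SimpleGraph.compl_adj, ne_eq, eq_comm (b := y)]
                tauto
              rcases this with h | h <;> simp only [hf, h, if_true, zero_mul, mul_zero, le_refl]
        _ = _ := by simp only [sum_boole, filter_mem_eq_inter, univ_inter]
    refine h1.trans ?_
    have h2 := card_union_le ({y | Γ.Adj u y ∧ Γ.Adj w y} : Finset V) {u, w}
    have h3 := card_le_two (a := u) (b := w)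
    have h4 := hco u w huw
    exact_mod_cast (by omega : #(({y | Γ.Adj u y ∧ Γ.Adj w y} : Finset V) ∪ {u, w}) ≤ n + 1)
  have hfff : ∑ v, ∑ x, ∑ y, f v x * f x y * f v y ≤ (n + 2) * ∑ v, ∑ x, f v x := by
    rw [mul_sum]
    refine sum_le_sum fun v _ => ?_
    have hself : ∑ y, f v y * f v y = ∑ y, f v y := by
      refine sum_congr rfl fun y _ => ?_
      simp only [hf]; split_ifs <;> norm_num
    have hx : ∀ x, ∑ y, f v x * f x y * f v y ≤
        (n + 1) * f v x + if x = v then ∑ y, f v y else 0 := by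
      intro x
      have h0 : 0 ≤ f v x := by simp only [hf]; split_ifs <;> norm_num
      simp only [mul_assoc, ← mul_sum]
      split_ifs with hxv
      · subst hxv
        have : f x x = 1 := by simp [hf]
        rw [hself, this]
        linarith
      · have := mul_le_mul_of_nonneg_left (hcommon x v hxv) h0
        linarith
    refine (sum_le_sum fun x _ => hx x).trans (le_of_eq ?_)
    rw [sum_add_distrib, ← mul_sum, sum_ite_eq' univ v]
    simp only [mem_univ, if_true]
    ring
  rw [sum_sub_distrib, sum_congr rfl fun v _ => htri v, sum_complement_triangles f hsym,
    ← mul_sum, sum_congr rfl fun v _ => hD v, sum_sub_distrib]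
  simp only [sum_const, nsmul_eq_mul, card_univ]
  set F := ∑ v, ∑ x, f v x with hF
  have hcs : F ^ 2 ≤ Fintype.card V * ∑ v, (∑ x, f v x) ^ 2 := by
    have := sq_sum_le_card_mul_sum_sq (s := univ) (f := fun v => ∑ x, f v x)
    simpa using this
  have hFN : F ≤ Fintype.card V * Fintype.card V := by
    calc F ≤ ∑ _v : V, ∑ _x : V, (1 : ℝ) := sum_le_sum fun _ _ => sum_le_sum fun _ _ => by
          simp only [hf]; split_ifs <;> norm_num
      _ = _ := by simp only [sum_const, nsmul_eq_mul, card_univ, mul_one]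
  have hVe : (Fintype.card V : ℝ) = 3 * n + 4 := by rw [hV]; push_cast; rfl
  have hn' : (10 : ℝ) ^ 5 ≤ n := by exact_mod_cast hn
  obtain ⟨p, hp⟩ : ∃ p, F = p * Fintype.card V := ⟨F / Fintype.card V, (div_mul_cancel₀ _ (by linarith)).symm⟩
  refine (triangle_count_estimate hn' hVe hp hFN hcs).trans ?_
  linarith

open Finset Classical in
/-- Many neighbourhoods in the complement have large average degree. -/
lemma many_dense_nbhds {V : Type*} [Fintype V] (Γ : SimpleGraph V) (n : ℕ)
    (hn : 10 ^ 5 ≤ n) (hV : Fintype.card V = 3 * n + 4)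
    (hco : ∀ u w, u ≠ w → #{y | Γ.Adj u y ∧ Γ.Adj w y} + 1 ≤ n) :
    1 / 10 ^ 3 * (n : ℝ) ≤ #{v | ({x | Γᶜ.Adj v x} : Finset V).Nonempty ∧
      482 / 1000 * (n : ℝ) * #{x | Γᶜ.Adj v x} ≤
        ∑ x with Γᶜ.Adj v x, (#{y | (nbhdGraph Γᶜ v).Adj x y} : ℝ)} := by
  have hn' : (10 : ℝ) ^ 5 ≤ n := by exact_mod_cast hn
  have hVe : (Fintype.card V : ℝ) = 3 * n + 4 := by rw [hV]; push_cast; rfl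
  set L : Finset V := {v | ({x | Γᶜ.Adj v x} : Finset V).Nonempty ∧
      482 / 1000 * (n : ℝ) * #{x | Γᶜ.Adj v x} ≤
        ∑ x with Γᶜ.Adj v x, (#{y | (nbhdGraph Γᶜ v).Adj x y} : ℝ)} with hL
  have hterm : ∀ v, ((∑ x with Γᶜ.Adj v x, #{y | (nbhdGraph Γᶜ v).Adj x y} : ℕ) : ℝ) -
      482 / 1000 * (n : ℝ) * #{x | Γᶜ.Adj v x} ≤
        if v ∈ L then (Fintype.card V : ℝ) * Fintype.card V else 0 := by
    intro v
    have h0 : (0 : ℝ) ≤ 482 / 1000 * (n : ℝ) * #{x | Γᶜ.Adj v x} := by positivity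
    split_ifs with hv
    · have h1 : ∑ x with Γᶜ.Adj v x, #{y | (nbhdGraph Γᶜ v).Adj x y} ≤
          Fintype.card V * Fintype.card V :=
        (sum_le_card_nsmul _ _ _ fun x _ => card_le_univ _).trans
          (Nat.mul_le_mul_right _ (card_le_univ _))
      have h2 : ((∑ x with Γᶜ.Adj v x, #{y | (nbhdGraph Γᶜ v).Adj x y} : ℕ) : ℝ) ≤
          (Fintype.card V : ℝ) * Fintype.card V := by exact_mod_cast h1
      linarith
    · by_cases hne : ({x | Γᶜ.Adj v x} : Finset V).Nonempty
      · simp only [hL, mem_filter, mem_univ, true_and, hne, not_le] at hv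
        push_cast
        linarith
      · rw [not_nonempty_iff_eq_empty] at hne
        rw [hne, sum_empty, card_empty]
        norm_num
  have hsum := (le_sum_compl_triangles Γ n hn hV hco).trans (sum_le_sum fun v _ => hterm v)
  rw [← sum_filter, filter_mem_eq_inter, univ_inter, sum_const, nsmul_eq_mul, ← mul_assoc] at hsum
  have h1 := le_of_mul_le_mul_right hsum (by linarith)
  have h2 : (#L : ℝ) * Fintype.card V ≤ #L * (301 / 100 * n) :=
    mul_le_mul_of_nonneg_left (by linarith) (by positivity)
  have h3 : 1 / 10 ^ 3 * (n : ℝ) * n ≤ #L * n := by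
    nlinarith
  exact le_of_mul_le_mul_right h3 (by linarith)

open Finset Classical in
/-- Enumerate the vertices of a path. -/
lemma PathTo.exists_enumeration {V : Type*} {H : SimpleGraph V} {w x : V} {U : Finset V}
    (h : PathTo H w U x) :
    ∃ f : ℕ → V, 0 < #U ∧ f 0 = w ∧ f (#U - 1) = x ∧
      (∀ i, i + 1 < #U → H.Adj (f i) (f (i + 1))) ∧
      (∀ i < #U, ∀ j < #U, f i = f j → i = j) ∧ ∀ i < #U, f i ∈ U := by
  induction h with
  | start => exact ⟨fun _ => w, by simp, rfl, rfl, by simp, by simp, by simp⟩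
  | @step U x y hU hxy hy ih =>
    obtain ⟨f, h0, hw, hx, hadj, hinj, hmem⟩ := ih
    have hf : ∀ i < #U, (if i = #U then y else f i) = f i := fun i hi => if_neg (by omega)
    rw [card_insert_of_notMem hy]
    refine ⟨fun i => if i = #U then y else f i, by omega, ?_, ?_, ?_, ?_, ?_⟩
    · exact (hf 0 h0).trans hw
    · exact if_pos (by omega)
    · intro i hi
      rcases Nat.lt_or_ge (i + 1) #U with h | h
      · simp only [hf i (by omega), hf _ h]
        exact hadj i h
      · obtain rfl : i = #U - 1 := by omega
        beta_reduce
        rwa [hf (#U - 1) (by omega), hx, if_pos (by omega : #U - 1 + 1 = #U)]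
    · intro i hi j hj hij
      rcases Nat.lt_or_ge i #U with h | h <;> rcases Nat.lt_or_ge j #U with h' | h'
      · simp only [hf i h, hf j h'] at hij
        exact hinj i h j h' hij
      · obtain rfl : j = #U := by omega
        simp only [hf i h, if_true] at hij
        exact absurd (hij ▸ hmem i h) hy
      · obtain rfl : i = #U := by omega
        simp only [hf j h', if_true] at hij
        exact absurd (hij ▸ hmem j h') hy
      · omega
    · intro i hi
      rcases Nat.lt_or_ge i #U with h | h
      · simp only [hf i h, mem_insert]
        exact .inr (hmem i h)
      · simp only [if_pos (by omega : i = #U), mem_insert_self]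

/-- A wheel from a hub `v` and a cyclic enumeration of neighbours of `v`. -/
lemma containsCopy_wheelGraph {V : Type*} {G : SimpleGraph V} {m : ℕ} {v : V} (c : ℕ → V)
    (hv : ∀ i < m, G.Adj v (c i)) (hadj : ∀ i, i + 1 < m → G.Adj (c i) (c (i + 1)))
    (hlast : G.Adj (c (m - 1)) (c 0)) (hinj : ∀ i < m, ∀ j < m, c i = c j → i = j) :
    ContainsCopy G (wheelGraph m) := by
  have hcyc : ∀ i j : Fin m, (i - j).val = 1 → G.Adj (c j) (c i) := by
    intro i j h
    rw [Fin.sub_def] at h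
    simp only at h
    have hi := i.2
    have hj := j.2
    rcases Nat.lt_or_ge (m - j.val + i.val) m with h' | h'
    · rw [Nat.mod_eq_of_lt h'] at h
      have h1 : i.val = 0 := by omega
      have h2 : j.val = m - 1 := by omega
      rw [h1, h2]
      exact hlast
    · rw [Nat.mod_eq_sub_mod h', Nat.mod_eq_of_lt (by omega)] at h
      have h1 : i.val = j.val + 1 := by omega
      rw [h1]
      exact hadj _ (by omega)
  refine ⟨⟨fun x => x.elim v fun i => c i, ?_⟩, ?_⟩
  · rintro (_ | i) (_ | j) h
    · exact absurd rfl h.ne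
    · exact hv j j.2
    · exact (hv i i.2).symm
    · obtain ⟨-, h⟩ := (SimpleGraph.fromRel_adj _ _ _).1 h
      have key : ∀ a b : Fin m, (some a = none ∨ ∃ i j : Fin m, some a = some i ∧
          some b = some j ∧ (SimpleGraph.cycleGraph m).Adj i j) → G.Adj (c a) (c b) := by
        rintro a b (h | ⟨a, b, h1, h2, h⟩)
        · cases h
        · cases h1
          cases h2
          rw [SimpleGraph.cycleGraph_adj'] at h
          exact h.elim (fun h => (hcyc _ _ h).symm) (hcyc _ _)
      exact h.elim (key i j) fun h => (key j i h).symm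
  · rintro (_ | i) (_ | j) h
    · rfl
    · exact absurd h (hv j j.2).ne
    · exact absurd h.symm (hv i i.2).ne
    · exact congrArg some (Fin.ext (hinj i i.2 j j.2 h))

open Finset Classical in
/-- Close a path in a neighbourhood through one further vertex to get a wheel. -/
lemma PathTo.containsCopy_wheelGraph {V : Type*} {G : SimpleGraph V} {m : ℕ} {v w x y : V}
    {U : Finset V} (hU : PathTo (nbhdGraph G v) w U x) (hUm : #U + 1 = m) (hy : y ∉ U)
    (hvx : G.Adj v x) (hvy : G.Adj v y) (hwy : G.Adj w y) (hxy : G.Adj x y) :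
    ContainsCopy G (wheelGraph m) := by
  subst hUm
  obtain ⟨f, h0, hw, hx, hadj, hinj, hmem⟩ := hU.exists_enumeration
  have hf : ∀ i < #U, (if i = #U then y else f i) = f i := fun i hi => if_neg (by omega)
  refine _root_.containsCopy_wheelGraph (v := v) (fun i => if i = #U then y else f i) ?_ ?_ ?_ ?_
  · intro i hi
    rcases Nat.lt_or_ge (i + 1) #U with h | h
    · simp only [hf i (by omega)]
      exact (hadj i h).2.1
    · rcases Nat.lt_or_ge i #U with h' | h'
      · simp only [hf i h']
        obtain rfl : i = #U - 1 := by omega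
        rwa [hx]
      · simpa only [if_pos (by omega : i = #U)] using hvy
  · intro i hi
    simp only [hf i (by omega)]
    rcases Nat.lt_or_ge (i + 1) #U with h | h
    · simp only [hf _ h]
      exact (hadj i h).1
    · obtain rfl : i = #U - 1 := by omega
      rwa [if_pos (by omega), hx]
  · rw [hf 0 h0, hw, Nat.add_sub_cancel, if_pos rfl]
    exact hwy.symm
  · intro i hi j hj hij
    rcases Nat.lt_or_ge i #U with h | h <;> rcases Nat.lt_or_ge j #U with h' | h'
    · simp only [hf i h, hf j h'] at hij
      exact hinj i h j h' hij
    · simp only [hf i h, if_pos (by omega : j = #U)] at hij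
      exact absurd (hij ▸ hmem i h) hy
    · simp only [hf j h', if_pos (by omega : i = #U)] at hij
      exact absurd (hij ▸ hmem j h') hy
    · omega

open Finset Classical in
/-- Two vertices with `n` common neighbours give a `K_{2,n}`. -/
lemma containsCopy_completeBipartiteGraph {V : Type*} [Fintype V] {Γ : SimpleGraph V} {n : ℕ}
    {u w : V} (huw : u ≠ w) (h : n ≤ #{y | Γ.Adj u y ∧ Γ.Adj w y}) :
    ContainsCopy Γ (completeBipartiteGraph (Fin 2) (Fin n)) := by
  obtain ⟨e⟩ : Nonempty (Fin n ↪ ({y | Γ.Adj u y ∧ Γ.Adj w y} : Finset V)) :=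
    Function.Embedding.nonempty_of_card_le (by rwa [Fintype.card_fin, Fintype.card_coe])
  have he : ∀ j, Γ.Adj u (e j) ∧ Γ.Adj w (e j) := fun j => (mem_filter.1 (e j).2).2
  have hadj : ∀ (i : Fin 2) j, Γ.Adj (if i = 0 then u else w) (e j) := fun i j => by
    split_ifs
    exacts [(he j).1, (he j).2]
  refine ⟨⟨Sum.elim (fun i => if i = 0 then u else w) fun j => e j, ?_⟩, ?_⟩
  · rintro (i | i) (j | j) h
    · simp at h
    · exact hadj i j
    · exact (hadj j i).symm
    · simp at h
  · rintro (i | i) (j | j) h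
    · simp only [RelHom.coeFn_mk, Sum.elim_inl] at h
      congr 1
      fin_cases i <;> fin_cases j <;> simp_all
    · exact absurd h (hadj i j).ne
    · exact absurd h.symm (hadj j i).ne
    · exact congrArg Sum.inr (e.injective (Subtype.ext h))

open Finset Classical in
/-- Few vertices are joined in the complement to neither of two given vertices with few common
neighbours. -/
lemma card_common_nonneighbours_le {V : Type*} [Fintype V] {Γ : SimpleGraph V} {n : ℕ} {u w : V}
    (h : #{y | Γ.Adj u y ∧ Γ.Adj w y} + 1 ≤ n) :
    #{y | ¬ Γᶜ.Adj u y ∧ ¬ Γᶜ.Adj w y} ≤ n + 1 := by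
  have hsub : ({y | ¬ Γᶜ.Adj u y ∧ ¬ Γᶜ.Adj w y} : Finset V) ⊆
      ({y | Γ.Adj u y ∧ Γ.Adj w y} : Finset V) ∪ {u, w} := by
    intro y hy
    simp only [mem_filter, mem_univ, true_and, SimpleGraph.compl_adj, mem_union, mem_insert,
      mem_singleton, ne_eq, eq_comm (b := y)] at hy ⊢
    tauto
  have h1 := (card_le_card hsub).trans (card_union_le _ _)
  have h2 := card_le_two (a := u) (b := w)
  omega

open Finset Classical in
/-- The upper bound: a large graph contains `K_{2,n}` or its complement contains an odd wheel. -/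
lemma exists_copy_of_card_eq : ∃ N₀ : ℕ, ∀ (V : Type) [Fintype V] (Γ : SimpleGraph V) (m n : ℕ),
    Odd m → 4 * 10 ^ 8 + 7 ≤ m → N₀ ≤ n → 4 * m ≤ n → Fintype.card V = 3 * n + 4 →
    ContainsCopy Γ (completeBipartiteGraph (Fin 2) (Fin n)) ∨
      ContainsCopy Γᶜ (wheelGraph m) := by
  obtain ⟨N₁, hN₁⟩ := many_joined_pairs
  refine ⟨N₁ + 10 ^ 25, fun V _ Γ m n hm hM hn hmn hV => ?_⟩
  by_contra! ⟨hK, hW⟩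
  have hco : ∀ u w, u ≠ w → #{y | Γ.Adj u y ∧ Γ.Adj w y} + 1 ≤ n := fun u w huw => by
    by_contra! hcon
    exact hK (containsCopy_completeBipartiteGraph huw (by omega))
  have hn' : (10 : ℝ) ^ 25 ≤ n := by exact_mod_cast (by omega : 10 ^ 25 ≤ n)
  have hVe : (Fintype.card V : ℝ) = 3 * n + 4 := by rw [hV]; push_cast; rfl
  have : Nonempty V := Fintype.card_pos_iff.1 (by omega)
  obtain ⟨T, hT⟩ : ∃ T : V → V → V → Prop, ∀ v a b, T v a b ↔ (nbhdGraph Γᶜ v).Adj a b ∧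
      ∀ y, y ≠ a → y ≠ b → ∃ U, PathTo (nbhdGraph Γᶜ v) a U b ∧ #U = m - 1 ∧ y ∉ U :=
    ⟨_, fun _ _ _ => Iff.rfl⟩
  obtain ⟨L, hL⟩ : ∃ L : Finset V, 1 / 10 ^ 3 * (n : ℝ) ≤ #L ∧
      ∀ v ∈ L, 6 / 100 * (n : ℝ) ^ 2 ≤ #{e : V × V | T v e.1 e.2} := by
    refine ⟨_, many_dense_nbhds Γ n (by omega) hV hco, fun v hv => ?_⟩
    obtain ⟨-, hne, hd⟩ := mem_filter.1 hv
    simp only [hT]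
    exact hN₁ V (nbhdGraph Γᶜ v) _ n m (by omega) hm hM hmn hV hne
      (fun x y h => by simpa using h.2.1) hd
  have hsum : 1 / 10 ^ 6 * (Fintype.card V : ℝ) ^ 3 ≤
      ∑ v, (#{e : V × V | T v e.1 e.2} : ℝ) := by
    calc 1 / 10 ^ 6 * (Fintype.card V : ℝ) ^ 3
        ≤ 1 / 10 ^ 6 * (301 / 100 * n) ^ 3 := by
          gcongr
          linarith
      _ ≤ 1 / 10 ^ 3 * n * (6 / 100 * (n : ℝ) ^ 2) := by
          have : (0 : ℝ) ≤ (n : ℝ) ^ 3 := by positivity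
          linarith
      _ ≤ #L * (6 / 100 * (n : ℝ) ^ 2) := by
          have := hL.1
          gcongr
      _ ≤ ∑ v ∈ L, (#{e : V × V | T v e.1 e.2} : ℝ) := by
          rw [← nsmul_eq_mul]
          exact card_nsmul_le_sum _ _ _ hL.2
      _ ≤ _ := sum_le_sum_of_subset_of_nonneg (subset_univ _) fun _ _ _ => Nat.cast_nonneg _
  obtain ⟨u₁, u₁', u₂, u₂', u₃, u₃', h₁, h₂, h₃, hbox⟩ :=
    exists_box T (1 / 10 ^ 6) (by norm_num) (by rw [hVe]; linarith) (by rw [hVe]; linarith) hsum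
  have hwheel : ∀ w₁ w₂ w₃ y, T w₁ w₂ w₃ → Γᶜ.Adj w₁ y → Γᶜ.Adj w₂ y → ¬ Γᶜ.Adj w₃ y := by
    intro w₁ w₂ w₃ y hw hy₁ hy₂ hy₃
    rw [hT] at hw
    obtain ⟨U, hU, hUc, hyU⟩ := hw.2 y hy₂.ne' hy₃.ne'
    exact hW (hU.containsCopy_wheelGraph (by omega) hyU hw.1.2.2 hy₁ hy₂ hy₃)
  have hcover : (univ : Finset V) ⊆ ({y | ¬ Γᶜ.Adj u₁ y ∧ ¬ Γᶜ.Adj u₁' y} : Finset V) ∪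
      ({y | ¬ Γᶜ.Adj u₂ y ∧ ¬ Γᶜ.Adj u₂' y} : Finset V) ∪
      ({y | ¬ Γᶜ.Adj u₃ y ∧ ¬ Γᶜ.Adj u₃' y} : Finset V) := by
    intro y _
    simp only [mem_union, mem_filter, mem_univ, true_and, ← not_or]
    by_contra! ⟨⟨c₁, c₂⟩, c₃⟩
    obtain ⟨w₁, hw₁, hy₁⟩ : ∃ w, (w = u₁ ∨ w = u₁') ∧ Γᶜ.Adj w y :=
      c₁.elim (fun h => ⟨_, .inl rfl, h⟩) fun h => ⟨_, .inr rfl, h⟩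
    obtain ⟨w₂, hw₂, hy₂⟩ : ∃ w, (w = u₂ ∨ w = u₂') ∧ Γᶜ.Adj w y :=
      c₂.elim (fun h => ⟨_, .inl rfl, h⟩) fun h => ⟨_, .inr rfl, h⟩
    obtain ⟨w₃, hw₃, hy₃⟩ : ∃ w, (w = u₃ ∨ w = u₃') ∧ Γᶜ.Adj w y :=
      c₃.elim (fun h => ⟨_, .inl rfl, h⟩) fun h => ⟨_, .inr rfl, h⟩
    exact hwheel w₁ w₂ w₃ y (hbox w₁ hw₁ w₂ hw₂ w₃ hw₃) hy₁ hy₂ hy₃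
  have hcard := ((card_le_card hcover).trans (card_union_le _ _)).trans
    (Nat.add_le_add_right (card_union_le _ _) _)
  have := card_common_nonneighbours_le (hco u₁ u₁' h₁)
  have := card_common_nonneighbours_le (hco u₂ u₂' h₂)
  have := card_common_nonneighbours_le (hco u₃ u₃' h₃)
  rw [card_univ] at hcard
  omega

/-- Three disjoint cliques of order `n + 1`, indexed by the residues modulo three. -/
def threeCliques (n : ℕ) : SimpleGraph (Fin (3 * n + 3)) where
  Adj x y := x ≠ y ∧ x.val % 3 = y.val % 3
  symm := ⟨fun _ _ h => ⟨h.1.symm, h.2.symm⟩⟩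
  loopless := ⟨fun _ h => h.1 rfl⟩

lemma not_containsCopy_threeCliques {n : ℕ} (hn : 0 < n) :
    ¬ ContainsCopy (threeCliques n) (completeBipartiteGraph (Fin 2) (Fin n)) := by
  rintro ⟨f, hf⟩
  have hadj : ∀ i j, (f (.inl i)).val % 3 = (f (.inr j)).val % 3 := fun i j =>
    (f.map_rel (by simp : (completeBipartiteGraph (Fin 2) (Fin n)).Adj (.inl i) (.inr j))).2
  have hmod : ∀ s, (f s).val % 3 = (f (.inl 0)).val % 3 := by
    rintro (i | j)
    · rw [hadj i ⟨0, hn⟩, hadj 0 ⟨0, hn⟩]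
    · rw [hadj 0 j]
  have hinj : Function.Injective fun s => (⟨(f s).val / 3, by omega⟩ : Fin (n + 1)) := by
    intro s t hst
    have h1 := hmod s
    have h2 := hmod t
    have h3 : (f s).val / 3 = (f t).val / 3 := congrArg Fin.val hst
    exact hf (Fin.ext (by omega))
  have := Fintype.card_le_of_injective _ hinj
  simp only [Fintype.card_sum, Fintype.card_fin] at this
  omega

lemma not_containsCopy_compl_threeCliques {n m : ℕ} (hm : Odd m) (hm2 : 2 ≤ m) :
    ¬ ContainsCopy (threeCliques n)ᶜ (wheelGraph m) := by
  rintro ⟨f, -⟩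
  have hmod : ∀ s t, (wheelGraph m).Adj s t → (f s).val % 3 ≠ (f t).val % 3 := by
    intro s t hst heq
    obtain ⟨h1, h2⟩ := (SimpleGraph.compl_adj _ _ _).1 (f.map_rel hst)
    exact h2 ⟨h1, heq⟩
  have hhub : ∀ i : Fin m, (f none).val % 3 ≠ (f (some i)).val % 3 := fun i =>
    hmod _ _ ((SimpleGraph.fromRel_adj _ _ _).2 ⟨by simp, .inl (.inl rfl)⟩)
  have hcol : (SimpleGraph.cycleGraph m).Colorable 2 := by
    refine (SimpleGraph.Coloring.mk (fun i : Fin m =>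
      decide ((f (some i)).val % 3 = ((f none).val + 1) % 3)) ?_).colorable
    intro i j hij
    have h1 := hhub i
    have h2 := hhub j
    have h3 := hmod (some i) (some j)
      ((SimpleGraph.fromRel_adj _ _ _).2 ⟨by simpa using hij.ne, .inl (.inr ⟨i, j, rfl, rfl, hij⟩)⟩)
    simp only [ne_eq, decide_eq_decide]
    omega
  have h := hcol.chromaticNumber_le
  rw [SimpleGraph.chromaticNumber_cycleGraph_of_odd m hm2 hm] at h
  exact absurd h (by decide)

/-- There exist integers `N₀` and `M₀` such that for every odd integer `m ≥ M₀` and every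
integer `n` with `n ≥ N₀` and `n ≥ 4m`, the Ramsey number `R(K_{2,n}, W_m)` equals `3n + 4`:
every graph on `3n+4` vertices contains a copy of `K_{2,n}` or its complement contains a
copy of `W_m`, while some graph on `3n+3` vertices contains no `K_{2,n}` and its complement
contains no `W_m`. -/
theorem statement0 :
    ∃ N₀ M₀ : ℕ, ∀ m n : ℕ, Odd m → M₀ ≤ m → N₀ ≤ n → 4 * m ≤ n →
      (∀ Γ : SimpleGraph (Fin (3 * n + 4)),
          ContainsCopy Γ (completeBipartiteGraph (Fin 2) (Fin n)) ∨
          ContainsCopy Γᶜ (wheelGraph m)) ∧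
      (∃ Γ : SimpleGraph (Fin (3 * n + 3)),
          ¬ ContainsCopy Γ (completeBipartiteGraph (Fin 2) (Fin n)) ∧
          ¬ ContainsCopy Γᶜ (wheelGraph m)) := by
  obtain ⟨N₀, hN₀⟩ := exists_copy_of_card_eq
  refine ⟨N₀, 4 * 10 ^ 8 + 7, fun m n hm hM hn hmn => ⟨fun Γ => ?_, threeCliques n, ?_, ?_⟩⟩
  · exact hN₀ _ Γ m n hm hM hn hmn (Fintype.card_fin _)
  · exact not_containsCopy_threeCliques (by omega)
  · exact not_containsCopy_compl_threeCliques hm (by omega)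
end

section
/- Let n ≥ 1 be an integer and let G be a graph on 3n + 4 vertices that contains no copy of K_{2,n}. Let v be a vertex whose degree in the complement G̅ equals the maximum degree Δ(G̅), and suppose (3 − √3)(n + 1) ≤ Δ(G̅) ≤ (3/2)(n + 1) − 1. Let H̅ denote the subgraph of G̅ induced on N_{G̅}(v), and suppose there is exactly one vertex p ∈ N_{G̅}(v) with deg_{H̅}(p) < |N_{G̅}(v)|/10 + 1. Then the subgraph of G̅ induced on Q = N_{G̅}(v) \ {p} is not bipartite. -/
open SimpleGraph

/-- A graph is bipartite if its vertex set can be partitioned into two parts with every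
edge joining the two parts. -/
def IsBip {α : Type*} (G : SimpleGraph α) : Prop :=
  ∃ A : Set α, ∀ ⦃x y⦄, G.Adj x y → (x ∈ A ↔ y ∉ A)

open SimpleGraph Finset in
/-- In a `K_{2,n}`-free graph two distinct vertices have fewer than `n` common neighbours. -/
lemma card_common_neighbors_lt {V : Type*} [Fintype V] [DecidableEq V] (G : SimpleGraph V)
    [DecidableRel G.Adj] {n : ℕ}
    (hG : ¬ ContainsCopy G (completeBipartiteGraph (Fin 2) (Fin n))) {x y : V} (hxy : x ≠ y) :
    #{z | G.Adj x z ∧ G.Adj y z} < n := by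
  by_contra! h
  obtain ⟨t, ht, hcard⟩ := exists_subset_card_eq h
  let e : Fin n ≃ t := (t.equivFinOfCardEq hcard).symm
  have hadj : ∀ j, G.Adj x (e j) ∧ G.Adj y (e j) := fun j => by
    simpa using ht (e j).2
  have hpair : ∀ i j, G.Adj (![x, y] i) (e j) := fun i j => by
    fin_cases i
    · exact (hadj j).1
    · exact (hadj j).2
  refine hG ⟨⟨Sum.elim ![x, y] (fun j => (e j : V)), ?_⟩, ?_⟩
  · rintro (i | i) (j | j) hij
    · simp at hij
    · exact hpair i j
    · exact (hpair j i).symm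
    · simp at hij
  · refine Function.Injective.sumElim ?_ ?_ fun i j => (hpair i j).ne
    · intro i j hij
      fin_cases i <;> fin_cases j <;> simp_all [hxy.symm]
    · exact Subtype.val_injective.comp e.injective

open Finset in
/-- Second moment bound for a family of sets, each of size at least `s`, with pairwise
intersections of size at most `l`. -/
lemma second_moment_bound {α β : Type*} [DecidableEq α] (A : Finset α) (T : Finset β)
    (r : α → β → Prop) [∀ x z, Decidable (r x z)] {s l : ℕ} (hA : 0 < #A)
    (hs : ∀ x ∈ A, s ≤ #{z ∈ T | r x z})
    (hl : ∀ x ∈ A, ∀ y ∈ A, x ≠ y → #{z ∈ T | r x z ∧ r y z} ≤ l)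
    (hT : #T ≤ 2 * (#A * s)) :
    #A * s ^ 2 + #T * l ≤ #T * (s + #A * l) := by
  set c : β → ℕ := fun z => #{x ∈ A | r x z} with hc
  have hS : ∑ x ∈ A, #{z ∈ T | r x z} = ∑ z ∈ T, c z :=
    sum_card_bipartiteAbove_eq_sum_card_bipartiteBelow r
  have hQ : ∑ q ∈ A ×ˢ A, #{z ∈ T | r q.1 z ∧ r q.2 z} = ∑ z ∈ T, c z ^ 2 := by
    refine (sum_card_bipartiteAbove_eq_sum_card_bipartiteBelow
      (fun (q : α × α) z => r q.1 z ∧ r q.2 z)).trans (sum_congr rfl fun z _ => ?_)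
    rw [hc, sq, ← card_product, ← filter_product]
    rfl
  have hSlow : #A * s ≤ ∑ z ∈ T, c z := by
    rw [← hS, ← smul_eq_mul]
    exact card_nsmul_le_sum _ _ _ hs
  have hQup : ∑ z ∈ T, c z ^ 2 + #A * l ≤ ∑ z ∈ T, c z + #A * (#A * l) := by
    rw [← hQ, ← hS, sum_product, ← smul_eq_mul, ← smul_eq_mul, ← sum_const, ← sum_const,
      ← sum_add_distrib, ← sum_add_distrib]
    refine sum_le_sum fun x hx => ?_
    rw [← add_sum_erase _ _ hx]
    have h := sum_le_card_nsmul (A.erase x) (fun y => #{z ∈ T | r x z ∧ r y z}) l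
      fun y hy => hl x hx y (mem_of_mem_erase hy) (ne_of_mem_erase hy).symm
    have h' := card_erase_add_one hx
    simp only [and_self, smul_eq_mul] at h ⊢
    simp only [sum_const, smul_eq_mul]
    rw [← h']
    linarith
  have hCS : (∑ z ∈ T, c z) ^ 2 ≤ #T * ∑ z ∈ T, c z ^ 2 := sq_sum_le_card_mul_sum_sq
  generalize ∑ z ∈ T, c z = S at *
  generalize ∑ z ∈ T, c z ^ 2 = Q at *
  generalize #A = a at *
  generalize #T = g at *
  refine Nat.le_of_mul_le_mul_left ?_ hA
  zify at *
  have h1 : 0 ≤ (S - a * s : ℤ) * (S + a * s - g) :=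
    mul_nonneg (by linarith) (by linarith)
  have h2 := mul_le_mul_of_nonneg_left hQup (Int.natCast_nonneg g)
  nlinarith

open SimpleGraph Finset in
/-- In a `K_{2,n}`-free graph of minimum degree at least `k`, a clique none of whose vertices is
adjacent to `v` satisfies a quadratic inequality. -/
lemma clique_bound {V : Type*} [Fintype V] [DecidableEq V] (G : SimpleGraph V)
    [DecidableRel G.Adj] {n k s l : ℕ}
    (hG : ¬ ContainsCopy G (completeBipartiteGraph (Fin 2) (Fin n)))
    (A : Finset V) (v : V) (hA : 0 < #A) (hclique : ∀ x ∈ A, ∀ y ∈ A, x ≠ y → G.Adj x y)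
    (hvA : v ∉ A) (hv : ∀ x ∈ A, ¬ G.Adj x v)
    (hdeg : ∀ x ∈ A, k ≤ G.degree x) (hs : s + #A ≤ k + 1) (hl : n + 1 ≤ l + #A) {g : ℕ}
    (hg : g + #A + 1 = Fintype.card V) (hgs : g ≤ 2 * (#A * s)) :
    #A * s ^ 2 + g * l ≤ g * (s + #A * l) := by
  have hT : #(insert v A)ᶜ = g := by
    rw [card_compl, card_insert_of_notMem hvA]
    omega
  rw [← hT] at hgs ⊢
  refine second_moment_bound A _ G.Adj hA (fun x hx => ?_) (fun x hx y hy hxy => ?_) hgs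
  · have hsub : G.neighborFinset x ⊆ A.erase x ∪ {z ∈ (insert v A)ᶜ | G.Adj x z} := by
      intro z hz
      rw [mem_neighborFinset] at hz
      have hzv : z ≠ v := fun h => hv x hx (h ▸ hz)
      by_cases hzA : z ∈ A <;> simp [hzA, hzv, hz, hz.ne']
    have h := (card_le_card hsub).trans (card_union_le _ _)
    rw [card_neighborFinset_eq_degree] at h
    have h1 := card_erase_add_one hx
    have h2 := hdeg x hx
    omega
  · have hsub : (A.erase x).erase y ∪ {z ∈ (insert v A)ᶜ | G.Adj x z ∧ G.Adj y z} ⊆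
        ({z | G.Adj x z ∧ G.Adj y z} : Finset V) := by
      intro z hz
      simp only [mem_union, mem_erase, mem_filter, mem_univ, true_and] at hz ⊢
      rcases hz with ⟨hzy, hzx, hz⟩ | ⟨-, h⟩
      · exact ⟨hclique x hx z hz hzx.symm, hclique y hy z hz hzy.symm⟩
      · exact h
    have hdisj : Disjoint ((A.erase x).erase y)
        {z ∈ (insert v A)ᶜ | G.Adj x z ∧ G.Adj y z} := by
      rw [Finset.disjoint_left]
      intro z hz hz'
      simp_all
    have h := card_le_card hsub
    rw [card_union_of_disjoint hdisj] at h
    have h1 := card_erase_add_one hx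
    have h2 := card_erase_add_one (mem_erase.2 ⟨hxy.symm, hy⟩)
    have h3 := card_common_neighbors_lt G hG hxy
    omega

open SimpleGraph Finset in
/-- Removing one vertex from a finite set inducing a bipartite graph leaves an independent set
containing half of the original set, rounded down. -/
lemma exists_independent_of_isBip {V : Type*} [Fintype V] [DecidableEq V] (H : SimpleGraph V)
    [DecidableRel H.Adj] {v p : V} (hp : p ∈ H.neighborSet v)
    (hbip : IsBip (H.induce (H.neighborSet v \ {p}))) :
    ∃ A ⊆ H.neighborFinset v, #A = H.degree v / 2 ∧ ∀ x ∈ A, ∀ y ∈ A, ¬ H.Adj x y := by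
  classical
  obtain ⟨B, hB⟩ := hbip
  set Q := (H.neighborFinset v).erase p with hQ
  have hmem : ∀ x ∈ Q, x ∈ H.neighborSet v \ {p} := by
    intro x hx
    simpa [hQ, and_comm] using hx
  obtain ⟨P, hP⟩ : ∃ P : V → Prop, ∀ x (hx : x ∈ Q), P x ↔ ⟨x, hmem x hx⟩ ∈ B :=
    ⟨fun x => ∃ hx : x ∈ Q, ⟨x, hmem x hx⟩ ∈ B,
      fun x hx => ⟨fun ⟨_, h⟩ => h, fun h => ⟨hx, h⟩⟩⟩
  have hQcard : #Q + 1 = H.degree v := by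
    rw [hQ, card_erase_add_one (by simpa using hp), card_neighborFinset_eq_degree]
  have hsum : #{x ∈ Q | P x} + #{x ∈ Q | ¬ P x} = #Q := card_filter_add_card_filter_not P
  have key : ∀ x ∈ Q, ∀ y ∈ Q, H.Adj x y → (P x ↔ ¬ P y) := by
    intro x hx y hy hxy
    rw [hP x hx, hP y hy]
    exact @hB ⟨x, hmem x hx⟩ ⟨y, hmem y hy⟩ hxy
  have hsub : Q ⊆ H.neighborFinset v := erase_subset _ _
  rcases le_or_gt (H.degree v / 2) #{x ∈ Q | P x} with h | h
  · obtain ⟨A, hA, hcard⟩ := exists_subset_card_eq h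
    refine ⟨A, hA.trans ((filter_subset _ _).trans hsub), hcard, fun x hx y hy hxy => ?_⟩
    have hx' := mem_filter.1 (hA hx)
    have hy' := mem_filter.1 (hA hy)
    exact (key x hx'.1 y hy'.1 hxy).1 hx'.2 hy'.2
  · obtain ⟨A, hA, hcard⟩ := exists_subset_card_eq
      (show H.degree v / 2 ≤ #{x ∈ Q | ¬ P x} by omega)
    refine ⟨A, hA.trans ((filter_subset _ _).trans hsub), hcard, fun x hx y hy hxy => ?_⟩
    have hx' := mem_filter.1 (hA hx)
    have hy' := mem_filter.1 (hA hy)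
    exact hx'.2 ((key x hx'.1 y hy'.1 hxy).2 hy'.2)

/-- The clique inequality fails for a clique of size `d / 2` when the complement has
maximum degree `d` in the given range. -/
lemma clique_inequality_fails {m d : ℕ} (hlow : 126 * m ≤ 100 * d) (hm : 0 < m)
    (hhigh : 2 * d + 2 ≤ 3 * m) :
    ∃ s l g : ℕ, s + d + d / 2 = 3 * m + 1 ∧ l + d / 2 = m ∧ g + d / 2 = 3 * m ∧
      g ≤ 2 * (d / 2 * s) ∧ g * (s + d / 2 * l) < d / 2 * s ^ 2 + g * l := by
  obtain ⟨a, rfl | rfl⟩ := Nat.even_or_odd' d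
  · have ha : 3 ≤ a := by omega
    obtain ⟨u, rfl⟩ : ∃ u, m = a + u := ⟨m - a, by omega⟩
    have hu : a + 2 ≤ 3 * u := by omega
    have hdiv : 2 * a / 2 = a := by omega
    rw [hdiv]
    refine ⟨3 * u + 1, u, 3 * u + 2 * a, by omega, by omega, by omega, by nlinarith, ?_⟩
    zify at *
    have h1 : 0 ≤ (u : ℤ) * (a - 1) * (3 * u - (a + 2)) :=
      mul_nonneg (mul_nonneg (by linarith) (by linarith)) (by linarith)
    nlinarith [mul_nonneg (show 0 ≤ (4 * a - 7 : ℤ) by linarith)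
      (show 0 ≤ (3 * u - (a + 2) : ℤ) by linarith)]
  · have ha : 4 ≤ a := by
      by_contra! h
      interval_cases a <;> omega
    obtain ⟨u, rfl⟩ : ∃ u, m = a + u := ⟨m - a, by omega⟩
    have hu : a + 4 ≤ 3 * u := by omega
    have hdiv : (2 * a + 1) / 2 = a := by omega
    rw [hdiv]
    refine ⟨3 * u, u, 3 * u + 2 * a, by omega, by omega, by omega, by nlinarith, ?_⟩
    have hkey : a * (4 * a - 1 : ℤ) < 3 * (a + u) * (a - 1) := by
      rcases ha.eq_or_lt with rfl | ha
      · push_cast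
        omega
      · zify at *
        nlinarith [mul_nonneg (show 0 ≤ (a - 1 : ℤ) by linarith)
          (show 0 ≤ (3 * u - (a + 4) : ℤ) by linarith)]
    have hupos : 0 < u := by omega
    zify at *
    nlinarith [mul_pos hupos (sub_pos.2 hkey)]

/-- In the setting of the previous statement, if there is exactly one vertex
`p ∈ N_{G̅}(v)` whose degree in the induced subgraph `H̅ = G̅[N_{G̅}(v)]` is less than
`|N_{G̅}(v)|/10 + 1` (the degree of `x` in `H̅` being `|N_{G̅}(x) ∩ N_{G̅}(v)|`), then
the subgraph of `G̅` induced on `Q = N_{G̅}(v) \ {p}` is not bipartite. -/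
theorem statement8 (n : ℕ) (hn : 1 ≤ n)
    (G : SimpleGraph (Fin (3 * n + 4))) [DecidableRel G.Adj]
    (hG : ¬ ContainsCopy G (completeBipartiteGraph (Fin 2) (Fin n)))
    (v : Fin (3 * n + 4)) (hv : ∀ w, Gᶜ.degree w ≤ Gᶜ.degree v)
    (hlow : (3 - Real.sqrt 3) * (n + 1) ≤ (Gᶜ.degree v : ℝ))
    (hhigh : (Gᶜ.degree v : ℝ) ≤ (3 / 2 : ℝ) * (n + 1) - 1)
    (p : Fin (3 * n + 4)) (hp : p ∈ Gᶜ.neighborSet v)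
    (hpsmall : ((Gᶜ.neighborFinset p ∩ Gᶜ.neighborFinset v).card : ℝ) <
      (Gᶜ.degree v : ℝ) / 10 + 1)
    (huniq : ∀ x ∈ Gᶜ.neighborSet v, x ≠ p →
      (Gᶜ.degree v : ℝ) / 10 + 1 ≤ ((Gᶜ.neighborFinset x ∩ Gᶜ.neighborFinset v).card : ℝ)) :
    ¬ IsBip (Gᶜ.induce (Gᶜ.neighborSet v \ {p})) := by
  intro hbip
  have hsqrt : Real.sqrt 3 < 1.74 := by
    rw [Real.sqrt_lt' (by norm_num)]
    norm_num
  set d := Gᶜ.degree v with hd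
  have hdlow : 126 * (n + 1) ≤ 100 * d := by
    have h : (126 * (n + 1) : ℝ) ≤ 100 * d := by nlinarith
    exact_mod_cast h
  have hdhigh : 2 * d + 2 ≤ 3 * (n + 1) := by
    have h : (2 * d + 2 : ℝ) ≤ 3 * (n + 1) := by linarith
    exact_mod_cast h
  obtain ⟨A, hAsub, hcard, hind⟩ := exists_independent_of_isBip Gᶜ hp hbip
  obtain ⟨s, l, g, hs, hl, hg, hgs, hlt⟩ :=
    clique_inequality_fails hdlow n.succ_pos hdhigh
  rw [← hd] at hcard
  rw [← hcard] at hs hl hg hgs hlt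
  have hAv : ∀ x ∈ A, Gᶜ.Adj v x := fun x hx => by
    simpa only [mem_neighborFinset] using hAsub hx
  have hbound := clique_bound G (k := 3 * n + 3 - d) (s := s) (l := l) (g := g) hG A v
    (by omega)
    (fun x hx y hy hxy => by
      by_contra h
      exact hind x hx y hy ((compl_adj G x y).2 ⟨hxy, h⟩))
    (fun h => (hAv v h).ne rfl)
    (fun x hx h => ((compl_adj G v x).1 (hAv x hx)).2 h.symm)
    (fun x _ => by
      have h1 := hv x
      rw [degree_compl, Fintype.card_fin] at h1
      omega)
    (by omega) (by omega) (by rw [Fintype.card_fin]; omega) hgs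
  exact absurd hbound (not_le.2 hlt)
end
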